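/- Let X = ℝ/ℤ be the circle with its quotient metric d(x,y) = min{ |x̃ − ỹ|, 1 − |x̃ − ỹ| } (for representatives x̃, ỹ ∈ [0,1)), let q > 0, and let c(x,y) := d(x,y)^q. Then: if 0 < q < 1, then 2 ≤ r*_c(P(X)) < 20.27/(1 − q); if q = 1, then r*_c(P(X)) = 2; and if q > 1, then r*_c(P(X)) = ∞. -/

import Mathlib

open MeasureTheory ENNReal

noncomputable section

/-- The optimal transport cost `C*_c(P,Q)` between two Borel measures for the cost `c`:
the infimum of `∫ c dγ` over couplings `γ` of `(P, Q)`. -/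
def Cstar {X : Type*} [MeasurableSpace X] (c : X → X → ℝ) (P Q : Measure X) : ℝ≥0∞ :=
  ⨅ γ ∈ {γ : Measure (X × X) |
      IsProbabilityMeasure γ ∧ γ.map Prod.fst = P ∧ γ.map Prod.snd = Q},
    ∫⁻ z, ENNReal.ofReal (c z.1 z.2) ∂γ

/-- The standard probability space: `[0,1]` with Lebesgue measure. -/
def stdSpace : Measure ℝ := volume.restrict (Set.Icc (0 : ℝ) 1)

/-- `f` is a coupling of the family of probability measures `P` on the standard
probability space `([0,1], Lebesgue)`: each `f a` is measurable with law `P a`. -/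
structure IsCoupling {X A : Type*} [MeasurableSpace X]
    (P : A → Measure X) (f : A → ℝ → X) : Prop where
  measurable : ∀ a, Measurable (f a)
  law : ∀ a, stdSpace.map (f a) = P a

/-- The pairwise coupling ratio `r_c({X_α})` of a coupling `f` of the family `P`:
the least `r ≥ 1` such that `E[c(X_a, X_b)] ≤ r ⬝ C*_c(P_a, P_b)` for all `a, b`
(`∞` if no such `r` exists). -/
def couplingRatio {X A : Type*} [MeasurableSpace X]
    (c : X → X → ℝ) (P : A → Measure X) (f : A → ℝ → X) : ℝ≥0∞ :=
  sInf {r : ℝ≥0∞ | 1 ≤ r ∧ ∀ a b : A,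
    ∫⁻ u, ENNReal.ofReal (c (f a u) (f b u)) ∂stdSpace ≤ r * Cstar c (P a) (P b)}

/-- The optimal pairwise coupling ratio `r*_c({P_α})` of a family of probability
measures: the infimum of `r_c({X_α})` over all couplings of the family. -/
def optRatio {X A : Type*} [MeasurableSpace X]
    (c : X → X → ℝ) (P : A → Measure X) : ℝ≥0∞ :=
  ⨅ (f : A → ℝ → X) (_ : IsCoupling P f), couplingRatio c P f

/-- The optimal pairwise coupling ratio of the family of all Borel probability measures
on the circle `ℝ/ℤ` for the cost `c(x,y) = d(x,y)^q`, where `d(x,y) = ‖x − y‖` is the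
quotient metric `min {|x̃ − ỹ|, 1 − |x̃ − ỹ|}`. -/
def circleOptRatio (q : ℝ) : ℝ≥0∞ :=
  optRatio (fun x y : AddCircle (1 : ℝ) => ‖x - y‖ ^ q)
    (fun P : ProbabilityMeasure (AddCircle (1 : ℝ)) => (P : Measure (AddCircle (1 : ℝ))))

theorem exists_map_stdSpace_eq {Y : Type*} [MeasurableSpace Y] [StandardBorelSpace Y]
    (μ : Measure Y) [IsProbabilityMeasure μ] :
    ∃ g : ℝ → Y, Measurable g ∧ stdSpace.map g = μ := by
  have : Nonempty Y := μ.nonempty_of_neZero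
  obtain ⟨f, hf, hfμ⟩ := μ.exists_measurable_map_eq
  have hp : Measurable (Set.projIcc (0 : ℝ) 1 zero_le_one) := continuous_projIcc.measurable
  refine ⟨f ∘ Set.projIcc 0 1 zero_le_one, hf.comp hp, ?_⟩
  rw [← Measure.map_map hf hp, ← hfμ]
  congr 1
  have h : stdSpace = (volume : Measure unitInterval).map Subtype.val :=
    unitInterval.measurePreserving_coe.map_eq.symm
  rw [h, Measure.map_map hp measurable_subtype_coe]
  have : (Set.projIcc (0 : ℝ) 1 zero_le_one) ∘ Subtype.val = id := by
    ext x; simp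
  rw [this, Measure.map_id]

instance : IsProbabilityMeasure stdSpace := ⟨by simp [stdSpace]⟩

/-- The uniform distribution on the list of points `g 0, …, g (m - 1)`. -/
def uniformAtoms {X : Type*} [MeasurableSpace X] (m : ℕ) (g : ℕ → X) : Measure X :=
  (m : ℝ≥0∞)⁻¹ • ∑ k ∈ Finset.range m, Measure.dirac (g k)

section UniformAtoms

variable {X : Type*} [MeasurableSpace X]

theorem isProbabilityMeasure_uniformAtoms {m : ℕ} (hm : m ≠ 0) (g : ℕ → X) :
    IsProbabilityMeasure (uniformAtoms m g) := by
  constructor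
  simp only [uniformAtoms, Measure.smul_apply, Measure.finsetSum_apply, measure_univ]
  simp [ENNReal.inv_mul_cancel, hm]

theorem map_uniformAtoms {Y : Type*} [MeasurableSpace Y] (m : ℕ) (g : ℕ → X) {φ : X → Y}
    (hφ : Measurable φ) :
    (uniformAtoms m g).map φ = uniformAtoms m (fun k => φ (g k)) := by
  ext s hs
  rw [Measure.map_apply hφ hs]
  simp only [uniformAtoms, Measure.smul_apply, Measure.finsetSum_apply, Measure.dirac_apply' _ hs,
    Measure.dirac_apply' _ (hφ hs)]
  rfl

theorem Cstar_uniformAtoms_le [MeasurableSingletonClass X] (c : X → X → ℝ) {m : ℕ} (hm : m ≠ 0)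
    (g h : ℕ → X) :
    Cstar c (uniformAtoms m g) (uniformAtoms m h) ≤
      (m : ℝ≥0∞)⁻¹ * ∑ k ∈ Finset.range m, ENNReal.ofReal (c (g k) (h k)) := by
  refine (iInf₂_le (uniformAtoms m fun k => (g k, h k))
    ⟨isProbabilityMeasure_uniformAtoms hm _, map_uniformAtoms _ _ measurable_fst,
      map_uniformAtoms _ _ measurable_snd⟩).trans ?_
  simp [uniformAtoms, lintegral_smul_measure, lintegral_finsetSum_measure]

theorem ae_mem_uniformAtoms [MeasurableSingletonClass X] (m : ℕ) (g : ℕ → X) :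
    ∀ᵐ x ∂uniformAtoms m g, ∃ k < m, x = g k := by
  have hm' : (m : ℝ≥0∞)⁻¹ ≠ 0 := by simp
  rw [uniformAtoms, Measure.ae_ennreal_smul_measure_iff hm', ae_iff,
    Measure.finsetSum_apply, Finset.sum_eq_zero]
  intro k hk
  rw [← ae_iff, ae_dirac_eq]
  exact ⟨k, Finset.mem_range.1 hk, rfl⟩

end UniformAtoms

theorem IsCoupling.ae_mem {X A : Type*} [MeasurableSpace X] {P : A → Measure X} {f : A → ℝ → X}
    (hf : IsCoupling P f) (a : A) {p : X → Prop} (h : ∀ᵐ x ∂P a, p x) :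
    ∀ᵐ u ∂stdSpace, p (f a u) := by
  rw [← hf.law a] at h
  exact ae_of_ae_map (hf.measurable a).aemeasurable h

/-- The point `k / n` of the circle. -/
def circlePoint (n k : ℕ) : AddCircle (1 : ℝ) := ((k / n : ℝ) : AddCircle (1 : ℝ))

theorem circlePoint_add_self {n : ℕ} (hn : n ≠ 0) (k : ℕ) :
    circlePoint n (k + n) = circlePoint n k := by
  have hn' : (n : ℝ) ≠ 0 := by exact_mod_cast hn
  simp only [circlePoint]
  push_cast
  rw [add_div, div_self hn']
  exact AddCircle.coe_add_period 1 _

theorem circlePoint_sub (n i j : ℕ) :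
    circlePoint n i - circlePoint n j = (((i - j : ℝ) / n : ℝ) : AddCircle (1 : ℝ)) := by
  simp only [circlePoint, sub_div]
  rfl

theorem one_div_le_norm_circlePoint_sub {n i j : ℕ} (hn : n ≠ 0)
    (h : circlePoint n i ≠ circlePoint n j) :
    1 / (n : ℝ) ≤ ‖circlePoint n i - circlePoint n j‖ := by
  have hn' : (0 : ℝ) < n := by exact_mod_cast Nat.pos_of_ne_zero hn
  have h0 : ‖circlePoint n i - circlePoint n j‖ ≠ 0 := by
    rw [norm_ne_zero_iff, sub_ne_zero]; exact h
  rw [circlePoint_sub] at h0 ⊢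
  rw [UnitAddCircle.norm_eq] at h0 ⊢
  set z := round (((i : ℝ) - j) / n) with hz
  have e : ((i : ℝ) - j) / n - z = (((i - j - z * n : ℤ)) : ℝ) / n := by
    push_cast; field_simp
  rw [e] at h0 ⊢
  rw [abs_div, abs_of_pos hn']
  gcongr
  have : (i - j - z * n : ℤ) ≠ 0 := by
    intro h'; rw [h'] at h0; simp at h0
  exact_mod_cast Int.one_le_abs this

theorem norm_circlePoint_sub_succ_le (n i : ℕ) :
    ‖circlePoint n i - circlePoint n (i + 1)‖ ≤ 1 / n := by
  rw [norm_sub_rev, circlePoint_sub]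
  push_cast
  rw [add_sub_cancel_left]
  refine (QuotientAddGroup.norm_mk_le_norm).trans ?_
  rw [Real.norm_eq_abs, abs_of_nonneg (by positivity)]

theorem exists_ne_succ {X : Type*} (x : ℕ → X) {a b : ℕ} (hab : a ≤ b) (h : x a ≠ x b) :
    ∃ i, a ≤ i ∧ i < b ∧ x i ≠ x (i + 1) := by
  by_contra! H
  exact h (Nat.le_induction (m := a) (P := fun k _ => k ≤ b → x a = x k) (fun _ => rfl)
    (fun k hk ih hkb => (ih (by omega)).trans (H k hk (by omega))) b hab le_rfl)

/-- A map of the `n`-th roots of unity without fixed points changes value at least twice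
along the cycle. -/
theorem two_mul_le_sum_of_no_fixed_point {n : ℕ} {δ : ℝ≥0∞}
    (x : ℕ → AddCircle (1 : ℝ)) (C : AddCircle (1 : ℝ) → AddCircle (1 : ℝ) → ℝ≥0∞)
    (hC : ∀ i, x i ≠ x (i + 1) → δ ≤ C (x i) (x (i + 1)))
    (hper : x n = x 0) (hmem : ∃ j < n, x 0 = circlePoint n j)
    (hfix : ∀ i < n, x i ≠ circlePoint n i) :
    2 * δ ≤ ∑ i ∈ Finset.range n, C (x i) (x (i + 1)) := by
  obtain ⟨j, hj, hxj⟩ := hmem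
  have h1 : x 0 ≠ x j := by rw [hxj]; exact (hfix j hj).symm
  have h2 : x j ≠ x n := by rw [hper]; exact h1.symm
  obtain ⟨a, -, haj, ha⟩ := exists_ne_succ x (Nat.zero_le j) h1
  obtain ⟨b, hjb, hbn, hb⟩ := exists_ne_succ x hj.le h2
  calc 2 * δ = δ + δ := two_mul _
    _ ≤ C (x a) (x (a + 1)) + C (x b) (x (b + 1)) := add_le_add (hC a ha) (hC b hb)
    _ = ∑ i ∈ {a, b}, C (x i) (x (i + 1)) := by
        rw [Finset.sum_pair (by omega)]
    _ ≤ _ := Finset.sum_le_sum_of_subset (by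
        intro i hi; simp only [Finset.mem_insert, Finset.mem_singleton] at hi
        rw [Finset.mem_range]; omega)

theorem le_circleOptRatio {q : ℝ} {L : ℝ≥0∞}
    (h : ∀ (f : ProbabilityMeasure (AddCircle (1 : ℝ)) → ℝ → AddCircle (1 : ℝ)) (r : ℝ≥0∞),
      IsCoupling (fun P : ProbabilityMeasure (AddCircle (1 : ℝ)) => (P : Measure _)) f →
      (∀ a b, ∫⁻ u, ENNReal.ofReal (‖f a u - f b u‖ ^ q) ∂stdSpace ≤
        r * Cstar (fun x y : AddCircle (1 : ℝ) => ‖x - y‖ ^ q) (a : Measure _) b) → L ≤ r) :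
    L ≤ circleOptRatio q :=
  le_iInf₂ fun f hf => le_sInf fun r hr => h f r hf hr.2

theorem measurable_cost {q : ℝ} {f g : ℝ → AddCircle (1 : ℝ)} (hf : Measurable f)
    (hg : Measurable g) : Measurable fun u => ENNReal.ofReal (‖f u - g u‖ ^ q) :=
  ((hf.sub hg).norm.pow_const q).ennreal_ofReal

theorem two_mul_le_of_coupling {q : ℝ} (hq : 0 < q) (m : ℕ) (hm : m ≠ 0)
    {f : ProbabilityMeasure (AddCircle (1 : ℝ)) → ℝ → AddCircle (1 : ℝ)} {r : ℝ≥0∞}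
    (hf : IsCoupling (fun P : ProbabilityMeasure (AddCircle (1 : ℝ)) => (P : Measure _)) f)
    (hr : ∀ a b, ∫⁻ u, ENNReal.ofReal (‖f a u - f b u‖ ^ q) ∂stdSpace ≤
        r * Cstar (fun x y : AddCircle (1 : ℝ) => ‖x - y‖ ^ q) (a : Measure _) b) :
    2 * (m : ℝ≥0∞) ≤ r * (m + 1) := by
  set n := m + 1 with hn
  have hn0 : n ≠ 0 := by omega
  have hnpos : (0 : ℝ) < n := by positivity
  let P : ℕ → ProbabilityMeasure (AddCircle (1 : ℝ)) := fun i =>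
    ⟨uniformAtoms m fun k => circlePoint n (i + 1 + k), isProbabilityMeasure_uniformAtoms hm _⟩
  have hP : P n = P 0 := by
    apply Subtype.ext
    change uniformAtoms _ _ = uniformAtoms _ _
    congr 1
    ext k
    rw [← circlePoint_add_self hn0 (0 + 1 + k)]
    congr 1; omega
  set δ : ℝ≥0∞ := ENNReal.ofReal ((1 / n : ℝ) ^ q) with hδ
  have hδ0 : δ ≠ 0 := by rw [hδ]; simp; positivity
  have hδt : δ ≠ ⊤ := ENNReal.ofReal_ne_top
  have hcost : ∀ i, Cstar (fun x y : AddCircle (1 : ℝ) => ‖x - y‖ ^ q) (P i : Measure _) (P (i + 1))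
      ≤ (m : ℝ≥0∞)⁻¹ * δ := by
    intro i
    obtain ⟨m', rfl⟩ := Nat.exists_eq_succ_of_ne_zero hm
    have e : (P (i + 1) : Measure (AddCircle (1 : ℝ))) = uniformAtoms (m' + 1)
        (fun k => if k = 0 then circlePoint n i else circlePoint n (i + 1 + k)) := by
      change uniformAtoms _ _ = uniformAtoms _ _
      simp only [uniformAtoms]
      rw [Finset.sum_range_succ, Finset.sum_range_succ']
      congr 2
      · refine Finset.sum_congr rfl fun k _ => ?_
        simp only [Nat.add_eq_zero_iff, one_ne_zero, and_false, if_false]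
        congr 2; omega
      · simp only [if_true]
        rw [← circlePoint_add_self hn0 i]
        congr 2; omega
    rw [e]
    refine (Cstar_uniformAtoms_le _ hm _ _).trans ?_
    gcongr
    rw [Finset.sum_eq_single 0]
    · simp only [if_true, add_zero]
      rw [norm_sub_rev]
      exact ENNReal.ofReal_le_ofReal (Real.rpow_le_rpow (norm_nonneg _)
        (norm_circlePoint_sub_succ_le n i) hq.le)
    · intro k _ hk
      simp [hk, hq.ne']
    · simp
  have hae : ∀ᵐ u ∂stdSpace, ∀ i, ∃ k < m, f (P i) u = circlePoint n (i + 1 + k) :=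
    ae_all_iff.2 fun i => hf.ae_mem (P i) (ae_mem_uniformAtoms m _)
  have hlow : 2 * δ ≤ ∑ i ∈ Finset.range n,
      ∫⁻ u, ENNReal.ofReal (‖f (P i) u - f (P (i + 1)) u‖ ^ q) ∂stdSpace := by
    rw [← lintegral_finsetSum _ fun i _ => measurable_cost (hf.measurable _) (hf.measurable _)]
    calc 2 * δ = ∫⁻ _, 2 * δ ∂stdSpace := by simp
      _ ≤ _ := by
        refine lintegral_mono_ae ?_
        filter_upwards [hae] with u hu
        refine two_mul_le_sum_of_no_fixed_point (fun i => f (P i) u)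
          (fun x y => ENNReal.ofReal (‖x - y‖ ^ q)) ?_ (by simp only [hP]) ?_ ?_
        · intro i hi
          obtain ⟨k, -, hk⟩ := hu i
          obtain ⟨l, -, hl⟩ := hu (i + 1)
          simp only [hk, hl] at hi ⊢
          exact ENNReal.ofReal_le_ofReal (Real.rpow_le_rpow (by positivity)
            (one_div_le_norm_circlePoint_sub hn0 hi) hq.le)
        · obtain ⟨k, hk, hk'⟩ := hu 0
          exact ⟨0 + 1 + k, by omega, hk'⟩
        · intro i hi h
          obtain ⟨k, hk, hk'⟩ := hu i
          rw [h] at hk'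
          have h2 : ‖circlePoint n (i + 1 + k) - circlePoint n i‖ = 0 := by
            rw [hk', sub_self, norm_zero]
          rw [circlePoint_sub, norm_eq_zero] at h2
          have h3 : (((i + 1 + k : ℕ) : ℝ) - i) / n = (k + 1 : ℝ) / n := by push_cast; ring
          rw [h3, AddCircle.coe_eq_zero_iff_of_mem_Ico] at h2
          · have : (k + 1 : ℝ) / n ≠ 0 := by positivity
            exact this h2
          · refine ⟨by positivity, ?_⟩
            rw [div_lt_one hnpos, hn]
            push_cast
            have : (k : ℝ) < m := by exact_mod_cast hk
            linarith
  have hup : 2 * δ ≤ r * n * (m : ℝ≥0∞)⁻¹ * δ := by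
    refine hlow.trans ((Finset.sum_le_sum fun i _ => (hr _ _).trans
      (mul_le_mul_right (hcost i) r)).trans_eq ?_)
    rw [Finset.sum_const, Finset.card_range, nsmul_eq_mul]
    ring
  have h2 := (ENNReal.mul_le_mul_iff_left hδ0 hδt).1 hup
  have hm' : (m : ℝ≥0∞) ≠ 0 := by exact_mod_cast hm
  rw [← div_eq_mul_inv, ENNReal.le_div_iff_mul_le (Or.inl hm') (Or.inl (by simp))] at h2
  rw [hn] at h2
  exact_mod_cast h2

theorem two_le_circleOptRatio {q : ℝ} (hq : 0 < q) : 2 ≤ circleOptRatio q := by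
  refine le_circleOptRatio fun f r hf hr => ?_
  by_cases hrt : r = ⊤
  · simp [hrt]
  lift r to NNReal using hrt
  have h : ∀ m : ℕ, m ≠ 0 → 2 * (m : ℝ) ≤ r * (m + 1) := fun m hm => by
    have := two_mul_le_of_coupling hq m hm hf hr
    exact_mod_cast this
  by_contra! hlt
  have hlt' : (r : ℝ) < 2 := by exact_mod_cast hlt
  obtain ⟨m, hm⟩ := exists_nat_gt (r / (2 - r) : ℝ)
  rw [div_lt_iff₀ (by linarith)] at hm
  rcases eq_or_ne m 0 with rfl | hm0
  · simp at hm
  · linarith [h m hm0]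

theorem norm_circlePoint_antipodal {N i : ℕ} (hN : 2 ≤ N) :
    1 / 4 ≤ ‖circlePoint (2 * N) i - circlePoint (2 * N) (i + 1 + N)‖ := by
  have hN' : (2 : ℝ) ≤ N := by exact_mod_cast hN
  rw [norm_sub_rev, circlePoint_sub]
  have e : ((((i + 1 + N : ℕ) : ℝ) - i) / (2 * N : ℕ) : ℝ) = 1 - (1 / 2 - 1 / (2 * N)) := by
    push_cast; field_simp; ring
  have hle : 1 / (2 * N : ℝ) ≤ 1 / 4 := by
    rw [div_le_div_iff₀ (by positivity) (by norm_num)]; linarith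
  have hpos : 0 ≤ 1 / (2 * N : ℝ) := by positivity
  have e2 : ((1 - (1 / 2 - 1 / (2 * N)) : ℝ) : AddCircle (1 : ℝ)) =
      -((1 / 2 - 1 / (2 * N) : ℝ) : AddCircle (1 : ℝ)) := by
    rw [AddCircle.coe_sub, AddCircle.coe_period, zero_sub]
  rw [e, e2, norm_neg, (AddCircle.norm_coe_eq_abs_iff 1 one_ne_zero).2]
  · exact (by linarith : (1 / 4 : ℝ) ≤ 1 / 2 - 1 / (2 * N)).trans (le_abs_self _)
  · rw [abs_of_nonneg (by linarith), abs_one]; linarith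

theorem circlePoint_antipodal_ne {N i : ℕ} (hN : 2 ≤ N) :
    circlePoint (2 * N) (i + N) ≠ circlePoint (2 * N) i := by
  intro h
  have hN' : (2 : ℝ) ≤ N := by exact_mod_cast hN
  rw [← sub_eq_zero, circlePoint_sub] at h
  have e : ((((i + N : ℕ) : ℝ) - i) / (2 * N : ℕ) : ℝ) = 1 / 2 := by
    push_cast; field_simp; ring
  rw [e, AddCircle.coe_eq_zero_iff_of_mem_Ico ⟨by norm_num, by norm_num⟩] at h
  norm_num at h

/-- A point following the antipodal pairs `{k / 2N, k / 2N + 1 / 2}` through half a turn, and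
returning to its starting point, has to jump. -/
theorem exists_jump {N : ℕ} (hN : 2 ≤ N) (x : ℕ → AddCircle (1 : ℝ)) (hper : x N = x 0)
    (hmem : ∀ i, ∃ k < 2, x i = circlePoint (2 * N) (i + k * N)) :
    ∃ i < N, 1 / 4 ≤ ‖x i - x (i + 1)‖ := by
  by_contra! H
  obtain ⟨k, hk, hk0⟩ := hmem 0
  have h : ∀ i ≤ N, x i = circlePoint (2 * N) (i + k * N) := by
    intro i
    induction i with
    | zero => exact fun _ => hk0
    | succ i ih =>
      intro hi
      have hxi := ih (by omega)
      have hj := H i (by omega)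
      obtain ⟨l, hl, hxl⟩ := hmem (i + 1)
      rw [hxl]
      by_cases hkl : l = k
      · rw [hkl]
      · refine absurd hj (not_lt.2 ?_)
        have h3 : circlePoint (2 * N) (i + 1 + l * N) =
            circlePoint (2 * N) (i + k * N + 1 + N) := by
          interval_cases k <;> interval_cases l
          · omega
          · congr 1; ring
          · rw [← circlePoint_add_self (by omega)]; congr 1; ring
          · omega
        rw [hxi, hxl, h3]
        exact norm_circlePoint_antipodal hN
  refine circlePoint_antipodal_ne (i := 0 + k * N) hN ?_
  rw [← hk0, ← hper, h N le_rfl]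
  congr 1; ring

theorem rpow_le_of_coupling {q : ℝ} (hq : 0 < q) {N : ℕ} (hN : 2 ≤ N)
    {f : ProbabilityMeasure (AddCircle (1 : ℝ)) → ℝ → AddCircle (1 : ℝ)} {r : ℝ≥0∞}
    (hf : IsCoupling (fun P : ProbabilityMeasure (AddCircle (1 : ℝ)) => (P : Measure _)) f)
    (hr : ∀ a b, ∫⁻ u, ENNReal.ofReal (‖f a u - f b u‖ ^ q) ∂stdSpace ≤
        r * Cstar (fun x y : AddCircle (1 : ℝ) => ‖x - y‖ ^ q) (a : Measure _) b) :
    ENNReal.ofReal ((1 / 4 : ℝ) ^ q) ≤ N * (r * ENNReal.ofReal ((1 / (2 * N : ℕ) : ℝ) ^ q)) := by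
  let P : ℕ → ProbabilityMeasure (AddCircle (1 : ℝ)) := fun i =>
    ⟨uniformAtoms 2 fun k => circlePoint (2 * N) (i + k * N),
      isProbabilityMeasure_uniformAtoms two_ne_zero _⟩
  have hP : P N = P 0 := by
    apply Subtype.ext
    change uniformAtoms _ _ = uniformAtoms _ _
    simp only [uniformAtoms, Finset.sum_range_succ, Finset.sum_range_zero, zero_add, zero_mul,
      add_zero, one_mul]
    rw [add_comm (Measure.dirac (circlePoint (2 * N) N)), ← two_mul,
      ← circlePoint_add_self (n := 2 * N) (by omega) 0, zero_add]
  have hcost : ∀ i, Cstar (fun x y : AddCircle (1 : ℝ) => ‖x - y‖ ^ q) (P i : Measure _) (P (i + 1))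
      ≤ ENNReal.ofReal ((1 / (2 * N : ℕ) : ℝ) ^ q) := by
    intro i
    refine (Cstar_uniformAtoms_le _ two_ne_zero _ _).trans ?_
    calc _ ≤ ((2 : ℕ) : ℝ≥0∞)⁻¹ * ∑ k ∈ Finset.range 2,
        ENNReal.ofReal ((1 / (2 * N : ℕ) : ℝ) ^ q) := by
          gcongr with k _
          have := norm_circlePoint_sub_succ_le (2 * N) (i + k * N)
          rwa [show i + k * N + 1 = i + 1 + k * N by ring] at this
      _ = _ := by
          rw [Finset.sum_const, Finset.card_range, nsmul_eq_mul, ← mul_assoc,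
            ENNReal.inv_mul_cancel (by simp) (by simp), one_mul]
  have hae : ∀ᵐ u ∂stdSpace, ∀ i, ∃ k < 2, f (P i) u = circlePoint (2 * N) (i + k * N) :=
    ae_all_iff.2 fun i => hf.ae_mem (P i) (ae_mem_uniformAtoms 2 _)
  calc ENNReal.ofReal ((1 / 4 : ℝ) ^ q)
      = ∫⁻ _, ENNReal.ofReal ((1 / 4 : ℝ) ^ q) ∂stdSpace := by simp
    _ ≤ ∫⁻ u, ∑ i ∈ Finset.range N,
        ENNReal.ofReal (‖f (P i) u - f (P (i + 1)) u‖ ^ q) ∂stdSpace := by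
        refine lintegral_mono_ae ?_
        filter_upwards [hae] with u hu
        obtain ⟨i, hi, hle⟩ := exists_jump hN (fun i => f (P i) u) (by simp only [hP]) hu
        refine le_trans ?_ (Finset.single_le_sum (fun _ _ => zero_le) (Finset.mem_range.2 hi))
        exact ENNReal.ofReal_le_ofReal (Real.rpow_le_rpow (by norm_num) hle hq.le)
    _ = ∑ i ∈ Finset.range N,
        ∫⁻ u, ENNReal.ofReal (‖f (P i) u - f (P (i + 1)) u‖ ^ q) ∂stdSpace :=
        lintegral_finsetSum _ fun i _ => measurable_cost (hf.measurable _) (hf.measurable _)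
    _ ≤ ∑ i ∈ Finset.range N, r * ENNReal.ofReal ((1 / (2 * N : ℕ) : ℝ) ^ q) :=
        Finset.sum_le_sum fun i _ => (hr _ _).trans (mul_le_mul_right (hcost i) r)
    _ = _ := by rw [Finset.sum_const, Finset.card_range, nsmul_eq_mul]

theorem circleOptRatio_eq_top {q : ℝ} (hq : 1 < q) : circleOptRatio q = ⊤ := by
  rw [eq_top_iff]
  refine le_circleOptRatio fun f r hf hr => ?_
  by_contra! hrt
  lift r to NNReal using hrt.ne
  have hq0 : 0 < q := by linarith
  have h : ∀ N : ℕ, 2 ≤ N → (N : ℝ) ^ (q - 1) ≤ r * 2 ^ q := fun N hN => by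
    have hN0 : (0 : ℝ) < N := by exact_mod_cast (by omega : 0 < N)
    have h1 := rpow_le_of_coupling hq0 hN hf hr
    have h2 : ENNReal.ofReal ((1 / 4 : ℝ) ^ q) ≤
        ENNReal.ofReal (N * (r * (1 / (2 * N : ℕ) : ℝ) ^ q)) := by
      rwa [ENNReal.ofReal_mul hN0.le, ENNReal.ofReal_mul r.coe_nonneg, ENNReal.ofReal_natCast,
        ENNReal.ofReal_coe_nnreal]
    rw [ENNReal.ofReal_le_ofReal_iff (by positivity)] at h2
    push_cast at h2
    rw [Real.div_rpow (by norm_num) (by positivity), Real.div_rpow (by norm_num) (by positivity),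
      Real.one_rpow, Real.mul_rpow (by norm_num) hN0.le,
      show (4 : ℝ) = 2 * 2 by norm_num, Real.mul_rpow (by norm_num) (by norm_num)] at h2
    rw [Real.rpow_sub hN0, Real.rpow_one]
    have h2q : (0 : ℝ) < 2 ^ q := by positivity
    have hNq : (0 : ℝ) < (N : ℝ) ^ q := by positivity
    rw [div_le_iff₀ hN0]
    field_simp at h2
    linarith
  have ht := (tendsto_rpow_atTop (by linarith : 0 < q - 1)).comp
    (tendsto_natCast_atTop_atTop (R := ℝ))
  obtain ⟨N, hN⟩ := ((ht.eventually_gt_atTop (r * 2 ^ q : ℝ)).and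
    (Filter.eventually_ge_atTop 2)).exists
  exact absurd (h N hN.2) (not_le.2 hN.1)

/-- The Markov kernel sending `u` to the translate of `P` by `u`. -/
def translateKernel (P : Measure (AddCircle (1 : ℝ))) [IsProbabilityMeasure P] :
    ProbabilityTheory.Kernel (AddCircle (1 : ℝ)) (AddCircle (1 : ℝ)) where
  toFun u := P.map (· + u)
  measurable' := by
    refine Measure.measurable_of_measurable_coe _ fun s hs => ?_
    have : (fun u => (P.map (· + u)) s) = fun u => P (Prod.mk u ⁻¹' {z | z.2 + z.1 ∈ s}) := by
      ext u
      rw [Measure.map_apply (measurable_add_const u) hs]; rfl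
    rw [this]
    exact measurable_measure_prodMk_left ((measurable_snd.add measurable_fst) hs)

theorem translateKernel_apply (P : Measure (AddCircle (1 : ℝ))) [IsProbabilityMeasure P]
    (u : AddCircle (1 : ℝ)) : translateKernel P u = P.map (· + u) := rfl

instance (P : Measure (AddCircle (1 : ℝ))) [IsProbabilityMeasure P] :
    ProbabilityTheory.IsMarkovKernel (translateKernel P) :=
  ⟨fun u => by
    rw [translateKernel_apply]
    exact Measure.isProbabilityMeasure_map (measurable_add_const u).aemeasurable⟩

theorem circleOptRatio_le {q : ℝ} {Ω : Type*} [MeasurableSpace Ω] [StandardBorelSpace Ω]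
    (μ : Measure Ω) [IsProbabilityMeasure μ]
    (Y : Measure (AddCircle (1 : ℝ)) → Ω → AddCircle (1 : ℝ))
    (hY : ∀ (κ : ProbabilityTheory.Kernel (AddCircle (1 : ℝ)) (AddCircle (1 : ℝ)))
      [ProbabilityTheory.IsMarkovKernel κ],
      Measurable fun z : AddCircle (1 : ℝ) × Ω => Y (κ z.1) z.2)
    (hlaw : ∀ (P : Measure (AddCircle (1 : ℝ))) [IsProbabilityMeasure P], μ.map (Y P) = P)
    (Φ : AddCircle (1 : ℝ) → AddCircle (1 : ℝ) → ℝ≥0∞) (hΦ : Measurable (Function.uncurry Φ))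
    (hcost : ∀ (γ : Measure (AddCircle (1 : ℝ) × AddCircle (1 : ℝ))) [IsProbabilityMeasure γ],
      ∫⁻ ω, ENNReal.ofReal (‖Y (γ.map Prod.fst) ω - Y (γ.map Prod.snd) ω‖ ^ q) ∂μ ≤
        ∫⁻ z, Φ z.1 z.2 ∂γ)
    {K : ℝ≥0∞} (hK1 : 1 ≤ K) (hKtop : K ≠ ⊤)
    (hK : ∀ x y, ∫⁻ u, Φ (x + u) (y + u) ≤ K * ENNReal.ofReal (‖x - y‖ ^ q)) :
    circleOptRatio q ≤ K := by
  have : IsProbabilityMeasure (volume : Measure (AddCircle (1 : ℝ))) := ⟨UnitAddCircle.measure_univ⟩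
  let ν : Measure (AddCircle (1 : ℝ) × Ω) := volume.prod μ
  obtain ⟨g, hg, hgν⟩ := exists_map_stdSpace_eq ν
  let Z : ProbabilityMeasure (AddCircle (1 : ℝ)) → AddCircle (1 : ℝ) × Ω → AddCircle (1 : ℝ) :=
    fun P z => Y (translateKernel (P : Measure _) z.1) z.2 - z.1
  have hZ : ∀ P, Measurable (Z P) := fun P =>
      (hY (translateKernel (P : Measure _))).sub measurable_fst
  have hZlaw : ∀ P : ProbabilityMeasure (AddCircle (1 : ℝ)), ν.map (Z P) = P := by
    intro P
    ext s hs
    rw [Measure.map_apply (hZ P) hs, Measure.prod_apply (hZ P hs)]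
    have key : ∀ u, μ (Prod.mk u ⁻¹' (Z P ⁻¹' s)) = (P : Measure _) s := by
      intro u
      have hm : Measurable fun ω => Y (translateKernel (P : Measure _) u) ω :=
        (hY (translateKernel (P : Measure (AddCircle (1 : ℝ))))).comp measurable_prodMk_left
      have hs' : MeasurableSet ((· - u) ⁻¹' s) := (measurable_sub_const u) hs
      change μ ((fun ω => Y (translateKernel (P : Measure _) u) ω) ⁻¹' ((· - u) ⁻¹' s)) = _
      rw [← Measure.map_apply hm hs', hlaw, translateKernel_apply,
        Measure.map_apply (measurable_add_const u) hs']
      congr 1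
      ext x; simp
    simp only [key]
    simp
  refine (iInf₂_le (fun P => Z P ∘ g) ⟨fun P => (hZ P).comp hg, fun P => ?_⟩).trans
    (sInf_le ⟨hK1, fun P Q => ?_⟩)
  swap
  · rw [← Measure.map_map (hZ P) hg, hgν, hZlaw]
  have hcm : Measurable fun z => ENNReal.ofReal (‖Z P z - Z Q z‖ ^ q) :=
    (((hZ P).sub (hZ Q)).norm.pow_const q).ennreal_ofReal
  rw [Cstar, mul_comm, ← ENNReal.div_le_iff_le_mul
    (Or.inl (zero_lt_one.trans_le hK1).ne') (Or.inl hKtop)]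
  · refine le_iInf₂ fun γ ⟨hγ, hγP, hγQ⟩ => ?_
    replace hγP : γ.map Prod.fst = (P : Measure _) := hγP
    replace hγQ : γ.map Prod.snd = (Q : Measure _) := hγQ
    rw [ENNReal.div_le_iff_le_mul (Or.inl (zero_lt_one.trans_le hK1).ne') (Or.inl hKtop), mul_comm]
    have hsh : ∀ u : AddCircle (1 : ℝ), Measurable
        (Prod.map (· + u) (· + u) : AddCircle (1 : ℝ) × AddCircle (1 : ℝ) → _) := fun u =>
      (measurable_add_const u).prodMap (measurable_add_const u)
    have hΦu : Measurable fun p : AddCircle (1 : ℝ) × (AddCircle (1 : ℝ) × AddCircle (1 : ℝ)) =>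
        Φ (p.2.1 + p.1) (p.2.2 + p.1) :=
      hΦ.comp (((measurable_fst.comp measurable_snd).add measurable_fst).prodMk
        ((measurable_snd.comp measurable_snd).add measurable_fst))
    calc ∫⁻ t, ENNReal.ofReal (‖Z P (g t) - Z Q (g t)‖ ^ q) ∂stdSpace
        = ∫⁻ z, ENNReal.ofReal (‖Z P z - Z Q z‖ ^ q) ∂ν := by
          rw [← hgν, lintegral_map hcm hg]
      _ = ∫⁻ u, ∫⁻ ω, ENNReal.ofReal (‖Z P (u, ω) - Z Q (u, ω)‖ ^ q) ∂μ :=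
          lintegral_prod _ hcm.aemeasurable
      _ ≤ ∫⁻ u, ∫⁻ z, Φ (z.1 + u) (z.2 + u) ∂γ := by
          refine lintegral_mono fun u => ?_
          have : IsProbabilityMeasure (γ.map (Prod.map (· + u) (· + u))) :=
            Measure.isProbabilityMeasure_map (hsh u).aemeasurable
          have h := hcost (γ.map (Prod.map (· + u) (· + u)))
          rw [Measure.map_map measurable_fst (hsh u), Measure.map_map measurable_snd (hsh u),
            lintegral_map (f := fun z : AddCircle (1 : ℝ) × AddCircle (1 : ℝ) => Φ z.1 z.2)
              hΦ (hsh u)] at h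
          have h1 : γ.map (Prod.fst ∘ Prod.map (· + u) (· + u)) =
              translateKernel (P : Measure _) u := by
            rw [translateKernel_apply, ← hγP,
              Measure.map_map (measurable_add_const u) measurable_fst]
            rfl
          have h2 : γ.map (Prod.snd ∘ Prod.map (· + u) (· + u)) =
              translateKernel (Q : Measure _) u := by
            rw [translateKernel_apply, ← hγQ,
              Measure.map_map (measurable_add_const u) measurable_snd]
            rfl
          rw [h1, h2] at h
          simpa [Z] using h
      _ = ∫⁻ z, (∫⁻ u, Φ (z.1 + u) (z.2 + u)) ∂γ := lintegral_lintegral_swap hΦu.aemeasurable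
      _ ≤ ∫⁻ z, K * ENNReal.ofReal (‖z.1 - z.2‖ ^ q) ∂γ := lintegral_mono fun z => hK _ _
      _ = K * ∫⁻ z, ENNReal.ofReal (‖z.1 - z.2‖ ^ q) ∂γ :=
          lintegral_const_mul' _ _ hKtop

/-- The representative in `[0, 1)` of a point of the circle. -/
def circleRep (x : AddCircle (1 : ℝ)) : ℝ := (AddCircle.equivIco 1 0 x : ℝ)

theorem measurable_circleRep : Measurable circleRep :=
  measurable_subtype_coe.comp (AddCircle.measurableEquivIco 1 0).measurable

theorem circleRep_nonneg (x : AddCircle (1 : ℝ)) : 0 ≤ circleRep x :=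
  (AddCircle.equivIco 1 0 x).2.1

theorem circleRep_lt_one (x : AddCircle (1 : ℝ)) : circleRep x < 1 :=
  (AddCircle.equivIco 1 0 x).2.2.trans_eq (zero_add 1)

theorem coe_circleRep (x : AddCircle (1 : ℝ)) : (circleRep x : AddCircle (1 : ℝ)) = x :=
  AddCircle.coe_equivIco

theorem circleRep_coe (t : ℝ) : circleRep (t : AddCircle (1 : ℝ)) = Int.fract t := by
  simp [circleRep, AddCircle.coe_equivIco_mk_apply]

theorem norm_coe_circle_le (t : ℝ) : ‖(t : AddCircle (1 : ℝ))‖ ≤ |t| :=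
  QuotientAddGroup.norm_mk_le_norm

theorem norm_coe_sub_coe_le (s t : ℝ) :
    ‖(s : AddCircle (1 : ℝ)) - (t : AddCircle (1 : ℝ))‖ ≤ |s - t| := by
  rw [← AddCircle.coe_sub]; exact norm_coe_circle_le _

theorem mul_one_sub_le_norm (x : AddCircle (1 : ℝ)) :
    circleRep x * (1 - circleRep x) ≤ ‖x‖ := by
  obtain ⟨s, h0, h1, hs⟩ : ∃ s, 0 ≤ s ∧ s < 1 ∧ circleRep x = s :=
    ⟨_, circleRep_nonneg x, circleRep_lt_one x, rfl⟩
  have hx : x = (s : AddCircle (1 : ℝ)) := by rw [← hs, coe_circleRep]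
  rw [hs, hx, UnitAddCircle.norm_eq]
  rcases le_or_gt (round s) 0 with h | h
  · have : (round s : ℝ) ≤ 0 := by exact_mod_cast h
    refine le_trans ?_ (le_abs_self _)
    nlinarith
  · have : (1 : ℝ) ≤ round s := by exact_mod_cast h
    refine le_trans ?_ (neg_le_abs _)
    nlinarith

theorem lintegral_abs_circleRep_sub_le (x y : AddCircle (1 : ℝ)) :
    ∫⁻ u, ENNReal.ofReal |circleRep (x + u) - circleRep (y + u)| ≤
      2 * ENNReal.ofReal (‖x - y‖ ^ (1 : ℝ)) := by
  set z := x - y with hz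
  set s := circleRep z with hs
  have h0 : 0 ≤ s := circleRep_nonneg z
  have h1 : s < 1 := circleRep_lt_one z
  have hzs : z = (s : AddCircle (1 : ℝ)) := (coe_circleRep z).symm
  have e1 : ∫⁻ u, ENNReal.ofReal |circleRep (x + u) - circleRep (y + u)| =
      ∫⁻ u, ENNReal.ofReal |circleRep (z + u) - circleRep u| := by
    rw [← lintegral_add_left_eq_self _ (-y : AddCircle (1 : ℝ))]
    refine lintegral_congr fun u => ?_
    rw [hz, show x + (-y + u) = x - y + u by abel, show y + (-y + u) = u by abel]
  rw [e1, ← UnitAddCircle.lintegral_preimage 0]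
  have hpt : ∀ t ∈ Set.Ioo (0 : ℝ) 1,
      ENNReal.ofReal |circleRep (z + (t : AddCircle (1 : ℝ))) - circleRep (t : AddCircle (1 : ℝ))| ≤
      (Set.Ioc 0 (1 - s)).indicator (fun _ => ENNReal.ofReal s) t +
      (Set.Icc (1 - s) 1).indicator (fun _ => ENNReal.ofReal (1 - s)) t := by
    intro t ht
    rw [hzs, ← AddCircle.coe_add, circleRep_coe, circleRep_coe, Int.fract_eq_self.2 ⟨ht.1.le, ht.2⟩]
    rcases lt_or_ge (s + t) 1 with h | h
    · rw [Int.fract_eq_self.2 ⟨by linarith [ht.1], h⟩,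
        Set.indicator_of_mem (show t ∈ Set.Ioc 0 (1 - s) from ⟨ht.1, by linarith⟩)]
      simp [abs_of_nonneg h0]
    · rw [Set.indicator_of_mem (show t ∈ Set.Icc (1 - s) 1 from ⟨by linarith, ht.2.le⟩)]
      have : Int.fract (s + t) = s + t - 1 := by
        rw [Int.fract_eq_iff]
        exact ⟨by linarith, by linarith [ht.2], 1, by push_cast; ring⟩
      rw [this, show s + t - 1 - t = -(1 - s) by ring, abs_neg, abs_of_pos (by linarith)]
      exact le_add_self
  calc _ = ∫⁻ t in Set.Ioo (0 : ℝ) 1, ENNReal.ofReal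
        |circleRep (z + (t : AddCircle (1 : ℝ))) - circleRep (t : AddCircle (1 : ℝ))| := by
        rw [zero_add, restrict_Ioo_eq_restrict_Ioc]
    _ ≤ ∫⁻ t in Set.Ioo (0 : ℝ) 1, (Set.Ioc 0 (1 - s)).indicator (fun _ => ENNReal.ofReal s) t +
      (Set.Icc (1 - s) 1).indicator (fun _ => ENNReal.ofReal (1 - s)) t :=
        setLIntegral_mono' measurableSet_Ioo hpt
    _ ≤ ∫⁻ t, (Set.Ioc 0 (1 - s)).indicator (fun _ => ENNReal.ofReal s) t +
      (Set.Icc (1 - s) 1).indicator (fun _ => ENNReal.ofReal (1 - s)) t :=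
          setLIntegral_le_lintegral _ _
    _ = 2 * ENNReal.ofReal (s * (1 - s)) := by
        rw [lintegral_add_left (measurable_const.indicator measurableSet_Ioc),
          lintegral_indicator_const measurableSet_Ioc, lintegral_indicator_const measurableSet_Icc,
          Real.volume_Ioc, Real.volume_Icc, sub_zero, _root_.sub_sub_cancel,
          mul_comm (ENNReal.ofReal (1 - s)), ← ENNReal.ofReal_mul h0, two_mul]
    _ ≤ _ := by
        rw [Real.rpow_one]
        gcongr
        exact mul_one_sub_le_norm z

/-- The quantile function at level `v` of the law of the representative of a `P`-random point. -/
def circleQuantile (P : Measure (AddCircle (1 : ℝ))) (v : ℝ) : ℝ :=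
  stdSpace.real {t | P.real {x | circleRep x ≤ t} < v}

theorem measurableSet_circleRep_le (t : ℝ) : MeasurableSet {x | circleRep x ≤ t} :=
  measurable_circleRep measurableSet_Iic

theorem monotone_measureReal_circleRep_le (P : Measure (AddCircle (1 : ℝ)))
    [IsProbabilityMeasure P] : Monotone fun t => P.real {x | circleRep x ≤ t} :=
  fun _ _ hst => measureReal_mono fun _ hx => le_trans hx hst

theorem measurable_circleQuantile
    (κ : ProbabilityTheory.Kernel (AddCircle (1 : ℝ)) (AddCircle (1 : ℝ)))
    [ProbabilityTheory.IsMarkovKernel κ] :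
    Measurable fun z : AddCircle (1 : ℝ) × ℝ => circleQuantile (κ z.1) z.2 := by
  have h1 : Measurable fun p : AddCircle (1 : ℝ) × ℝ => (κ p.1) {x | circleRep x ≤ p.2} :=
    ProbabilityTheory.Kernel.measurable_kernel_prodMk_left
      (κ := κ.comap (Prod.fst : AddCircle (1 : ℝ) × ℝ → _) measurable_fst)
      (t := {w | circleRep w.2 ≤ w.1.2})
      (measurableSet_le (measurable_circleRep.comp measurable_snd)
        (measurable_snd.comp measurable_fst))
  have h2 : MeasurableSet {w : (AddCircle (1 : ℝ) × ℝ) × ℝ |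
      (κ w.1.1).real {x | circleRep x ≤ w.2} < w.1.2} :=
    measurableSet_lt (h1.ennreal_toReal.comp
      ((measurable_fst.comp measurable_fst).prodMk measurable_snd))
      (measurable_snd.comp measurable_fst)
  exact (measurable_measure_prodMk_left h2).ennreal_toReal

theorem stdSpace_real_Icc {t : ℝ} (h0 : 0 ≤ t) (h1 : t ≤ 1) : stdSpace.real (Set.Icc 0 t) = t := by
  rw [stdSpace, measureReal_restrict_apply measurableSet_Icc, Set.Icc_inter_Icc]
  simp [h0, h1]

theorem circleQuantile_le_iff (P : Measure (AddCircle (1 : ℝ))) [IsProbabilityMeasure P]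
    {t v : ℝ} (h0 : 0 ≤ t) (h1 : t < 1) :
    circleQuantile P v ≤ t ↔ v ≤ P.real {x | circleRep x ≤ t} := by
  have hmono := monotone_measureReal_circleRep_le P
  constructor
  · intro h
    by_contra! hlt
    have : IsProbabilityMeasure (P.map circleRep) :=
      Measure.isProbabilityMeasure_map measurable_circleRep.aemeasurable
    have hF : ∀ t, ProbabilityTheory.cdf (P.map circleRep) t = P.real {x | circleRep x ≤ t} := by
      intro t
      rw [ProbabilityTheory.cdf_eq_real,
        map_measureReal_apply measurable_circleRep measurableSet_Iic]
      rfl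
    have hev := ((ProbabilityTheory.cdf (P.map circleRep)).right_continuous t).eventually_lt_const
      (by rw [hF]; exact hlt)
    have hev2 : ∀ᶠ w in nhdsWithin t (Set.Ioi t), P.real {x | circleRep x ≤ w} < v :=
      (hev.filter_mono (nhdsWithin_mono _ Set.Ioi_subset_Ici_self)).mono fun w hw => by rwa [← hF]
    obtain ⟨w, hw, htw, hw1⟩ := (hev2.and (Ioo_mem_nhdsGT h1)).exists
    have : stdSpace.real (Set.Icc 0 w) ≤ circleQuantile P v :=
      measureReal_mono fun r hr => (hmono hr.2).trans_lt hw
    rw [stdSpace_real_Icc (h0.trans htw.le) hw1.le] at this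
    linarith
  · intro h
    have hsub : stdSpace.real {w | P.real {x | circleRep x ≤ w} < v} ≤ stdSpace.real (Set.Iic t) :=
      measureReal_mono fun w hw => by
        by_contra hc
        exact absurd (h.trans (hmono (not_le.1 hc).le)) (not_le.2 hw)
    refine hsub.trans (le_of_eq ?_)
    rw [stdSpace, measureReal_restrict_apply measurableSet_Iic]
    have : Set.Iic t ∩ Set.Icc 0 1 = Set.Icc 0 t := by
      ext w
      exact ⟨fun hw => ⟨hw.2.1, hw.1⟩, fun hw => ⟨hw.2, hw.1, hw.2.trans h1.le⟩⟩
    rw [this]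
    simp [h0]

theorem map_circleQuantile (P : Measure (AddCircle (1 : ℝ))) [IsProbabilityMeasure P] :
    stdSpace.map (circleQuantile P) = P.map circleRep := by
  have hm : Measurable (circleQuantile P) :=
    (measurable_circleQuantile (ProbabilityTheory.Kernel.const _ P)).comp
      (measurable_prodMk_left (x := (0 : AddCircle (1 : ℝ))))
  have : IsProbabilityMeasure (stdSpace.map (circleQuantile P)) :=
    Measure.isProbabilityMeasure_map hm.aemeasurable
  have : IsProbabilityMeasure (P.map circleRep) :=
    Measure.isProbabilityMeasure_map measurable_circleRep.aemeasurable
  refine Measure.ext_of_Iic _ _ fun t => ?_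
  rw [Measure.map_apply hm measurableSet_Iic,
    Measure.map_apply measurable_circleRep measurableSet_Iic]
  rcases lt_or_ge t 0 with ht | ht
  · have h1 : circleQuantile P ⁻¹' Set.Iic t = ∅ := by
      ext v; simpa [circleQuantile] using ht.trans_le measureReal_nonneg
    have h2 : circleRep ⁻¹' Set.Iic t = ∅ := by
      ext v; simpa using ht.trans_le (circleRep_nonneg v)
    simp [h1, h2]
  rcases lt_or_ge t 1 with ht1 | ht1
  · have hset : circleQuantile P ⁻¹' Set.Iic t = Set.Iic (P.real {x | circleRep x ≤ t}) := by
      ext v; exact circleQuantile_le_iff P ht ht1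
    rw [hset]
    have hr : P.real {x | circleRep x ≤ t} ≤ 1 := measureReal_le_one
    have hr0 : 0 ≤ P.real {x | circleRep x ≤ t} := measureReal_nonneg
    have : stdSpace (Set.Iic (P.real {x | circleRep x ≤ t})) =
        ENNReal.ofReal (P.real {x | circleRep x ≤ t}) := by
      rw [stdSpace, Measure.restrict_apply measurableSet_Iic]
      have : Set.Iic (P.real {x | circleRep x ≤ t}) ∩ Set.Icc 0 1 =
        Set.Icc 0 (P.real {x | circleRep x ≤ t}) := by
        ext w; simp; grind
      rw [this, Real.volume_Icc, sub_zero]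
    rw [this, ofReal_measureReal]
    rfl
  · have h1 : circleQuantile P ⁻¹' Set.Iic t = Set.univ := by
      ext v; simpa [circleQuantile] using (measureReal_le_one (μ := stdSpace)).trans ht1
    have h2 : circleRep ⁻¹' Set.Iic t = Set.univ := by
      ext v; simpa using (circleRep_lt_one v).le.trans ht1
    simp [h1, h2]

theorem prod_measure_swap {α β : Type*} [MeasurableSpace α] [MeasurableSpace β] (μ : Measure α)
    (ν : Measure β) [SFinite μ] [SFinite ν] {s : Set (α × β)} (hs : MeasurableSet s) :
    ∫⁻ x, ν {y | (x, y) ∈ s} ∂μ = ∫⁻ y, μ {x | (x, y) ∈ s} ∂ν :=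
  (Measure.prod_apply hs).symm.trans (Measure.prod_apply_symm hs)

theorem lintegral_abs_circleQuantile_sub_le
    (γ : Measure (AddCircle (1 : ℝ) × AddCircle (1 : ℝ))) [IsProbabilityMeasure γ] :
    ∫⁻ v, ENNReal.ofReal
      |circleQuantile (γ.map Prod.fst) v - circleQuantile (γ.map Prod.snd) v| ∂stdSpace ≤
      ∫⁻ z, ENNReal.ofReal |circleRep z.1 - circleRep z.2| ∂γ := by
  set F : ℝ → ℝ := fun t => (γ.map Prod.fst).real {x | circleRep x ≤ t} with hF
  set G : ℝ → ℝ := fun t => (γ.map Prod.snd).real {x | circleRep x ≤ t} with hG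
  have hF' : ∀ t, F t = γ.real {z | circleRep z.1 ≤ t} := fun t =>
    map_measureReal_apply measurable_fst (measurableSet_circleRep_le t)
  have hG' : ∀ t, G t = γ.real {z | circleRep z.2 ≤ t} := fun t =>
    map_measureReal_apply measurable_snd (measurableSet_circleRep_le t)
  have : IsProbabilityMeasure (γ.map Prod.fst) :=
    Measure.isProbabilityMeasure_map measurable_fst.aemeasurable
  have : IsProbabilityMeasure (γ.map Prod.snd) :=
    Measure.isProbabilityMeasure_map measurable_snd.aemeasurable
  have hFm : Measurable F := (monotone_measureReal_circleRep_le _).measurable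
  have hGm : Measurable G := (monotone_measureReal_circleRep_le _).measurable
  have hS : MeasurableSet (symmDiff {p : ℝ × ℝ | F p.2 < p.1} {p : ℝ × ℝ | G p.2 < p.1}) :=
    (measurableSet_lt (hFm.comp measurable_snd) measurable_fst).symmDiff
      (measurableSet_lt (hGm.comp measurable_snd) measurable_fst)
  have m1 : Measurable fun p : ℝ × (AddCircle (1 : ℝ) × AddCircle (1 : ℝ)) => circleRep p.2.1 :=
    measurable_circleRep.comp (measurable_fst.comp measurable_snd)
  have m2 : Measurable fun p : ℝ × (AddCircle (1 : ℝ) × AddCircle (1 : ℝ)) => circleRep p.2.2 :=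
    measurable_circleRep.comp (measurable_snd.comp measurable_snd)
  have hT : MeasurableSet (symmDiff
      {p : ℝ × (AddCircle (1 : ℝ) × AddCircle (1 : ℝ)) | circleRep p.2.1 ≤ p.1}
      {p : ℝ × (AddCircle (1 : ℝ) × AddCircle (1 : ℝ)) | circleRep p.2.2 ≤ p.1}) :=
    (measurableSet_le m1 measurable_fst).symmDiff (measurableSet_le m2 measurable_fst)
  calc _ ≤ ∫⁻ v, stdSpace {t | (v, t) ∈ symmDiff {p : ℝ × ℝ | F p.2 < p.1}
          {p : ℝ × ℝ | G p.2 < p.1}} ∂stdSpace := by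
        refine lintegral_mono fun v => ?_
        rw [← ofReal_measureReal]
        refine ENNReal.ofReal_le_ofReal ?_
        exact abs_measureReal_sub_le_measureReal_symmDiff
          (measurableSet_lt hFm measurable_const).nullMeasurableSet
          (measurableSet_lt hGm measurable_const).nullMeasurableSet
    _ = ∫⁻ t, stdSpace {v | (v, t) ∈ symmDiff {p : ℝ × ℝ | F p.2 < p.1}
          {p : ℝ × ℝ | G p.2 < p.1}} ∂stdSpace := prod_measure_swap _ _ hS
    _ ≤ ∫⁻ t, γ {z | (t, z) ∈ symmDiff
        {p : ℝ × (AddCircle (1 : ℝ) × AddCircle (1 : ℝ)) | circleRep p.2.1 ≤ p.1}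
        {p : ℝ × (AddCircle (1 : ℝ) × AddCircle (1 : ℝ)) | circleRep p.2.2 ≤ p.1}} ∂stdSpace := by
        refine lintegral_mono fun t => ?_
        rw [← ofReal_measureReal (μ := γ)]
        calc _ ≤ volume (Set.uIoc (F t) (G t)) := by
              refine (Measure.restrict_apply_le _ _).trans (measure_mono fun v hv => ?_)
              simp only [Set.mem_symmDiff, Set.mem_ofPred_eq, not_lt] at hv
              rw [Set.mem_uIoc]
              exact hv
          _ = ENNReal.ofReal |G t - F t| := Real.volume_uIoc
          _ ≤ _ := by
              refine ENNReal.ofReal_le_ofReal ?_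
              rw [abs_sub_comm, hF', hG']
              exact abs_measureReal_sub_le_measureReal_symmDiff
                (measurable_fst (measurableSet_circleRep_le t)).nullMeasurableSet
                (measurable_snd (measurableSet_circleRep_le t)).nullMeasurableSet
    _ = ∫⁻ z, stdSpace {t | (t, z) ∈ symmDiff
        {p : ℝ × (AddCircle (1 : ℝ) × AddCircle (1 : ℝ)) | circleRep p.2.1 ≤ p.1}
        {p : ℝ × (AddCircle (1 : ℝ) × AddCircle (1 : ℝ)) | circleRep p.2.2 ≤ p.1}} ∂γ :=
        prod_measure_swap _ _ hT
    _ ≤ _ := by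
        refine lintegral_mono fun z => ?_
        calc _ ≤ volume (Set.uIcc (circleRep z.1) (circleRep z.2)) := by
              refine (Measure.restrict_apply_le _ _).trans (measure_mono fun v hv => ?_)
              simp only [Set.mem_symmDiff, Set.mem_ofPred_eq, not_le] at hv
              rw [Set.mem_uIcc]
              exact hv.imp (fun h => ⟨h.1, h.2.le⟩) fun h => ⟨h.1, h.2.le⟩
          _ = _ := by rw [Real.volume_interval, abs_sub_comm]

theorem circleOptRatio_one_le : circleOptRatio 1 ≤ 2 := by
  refine circleOptRatio_le stdSpace (fun P v => (circleQuantile P v : AddCircle (1 : ℝ))) ?_ ?_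
    (fun x y => ENNReal.ofReal |circleRep x - circleRep y|) ?_ ?_ one_le_two (by simp)
    lintegral_abs_circleRep_sub_le
  · intro κ _
    exact AddCircle.measurable_mk'.comp (measurable_circleQuantile κ)
  · intro P _
    have hm : Measurable (circleQuantile P) :=
      (measurable_circleQuantile (ProbabilityTheory.Kernel.const _ P)).comp
        (measurable_prodMk_left (x := (0 : AddCircle (1 : ℝ))))
    have h : stdSpace.map ((fun t : ℝ => (t : AddCircle (1 : ℝ))) ∘ circleQuantile P) = P := by
      rw [← Measure.map_map AddCircle.measurable_mk' hm, map_circleQuantile,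
        Measure.map_map AddCircle.measurable_mk' measurable_circleRep]
      simp [Function.comp_def, coe_circleRep]
    exact h
  · exact ((measurable_circleRep.comp measurable_fst).sub
      (measurable_circleRep.comp measurable_snd)).abs.ennreal_ofReal
  · intro γ _
    refine le_trans (lintegral_mono fun v => ENNReal.ofReal_le_ofReal ?_)
      (lintegral_abs_circleQuantile_sub_le γ)
    rw [Real.rpow_one]
    exact norm_coe_sub_coe_le _ _

section Rejection

variable {E : Type*} [MeasurableSpace E] (μ : Measure E) [IsProbabilityMeasure μ]

theorem infinitePi_first_hit_le {S B : Set E} (hS : MeasurableSet S) (hB : MeasurableSet B) :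
    Measure.infinitePi (fun _ : ℕ => μ) {ω | ∃ k, (∀ i < k, ω i ∉ S) ∧ ω k ∈ B} ≤ μ B / μ S := by
  have hE : ∀ k, Measure.infinitePi (fun _ : ℕ => μ) {ω | (∀ i < k, ω i ∉ S) ∧ ω k ∈ B} =
      (1 - μ S) ^ k * μ B := by
    intro k
    have hset : {ω : ℕ → E | (∀ i < k, ω i ∉ S) ∧ ω k ∈ B} =
        Set.pi (Finset.range (k + 1)) fun i => if i < k then Sᶜ else B := by
      ext ω
      simp only [Set.mem_ofPred_eq, Set.mem_pi, Finset.coe_range, Set.mem_Iio]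
      constructor
      · rintro ⟨h1, h2⟩ i hi
        rcases Nat.lt_succ_iff_lt_or_eq.1 hi with h | rfl
        · simpa [h] using h1 i h
        · simpa using h2
      · intro h
        exact ⟨fun i hi => by simpa [hi] using h i (by omega), by simpa using h k (by omega)⟩
    rw [hset, Measure.infinitePi_pi _ (fun i _ => by split_ifs; exacts [hS.compl, hB]),
      Finset.prod_range_succ]
    simp only [lt_irrefl, if_false]
    congr 1
    rw [Finset.prod_congr rfl (g := fun _ => 1 - μ S), Finset.prod_const, Finset.card_range]
    intro i hi
    rw [if_pos (Finset.mem_range.1 hi), prob_compl_eq_one_sub hS]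
  have hU : {ω : ℕ → E | ∃ k, (∀ i < k, ω i ∉ S) ∧ ω k ∈ B} =
      ⋃ k, {ω | (∀ i < k, ω i ∉ S) ∧ ω k ∈ B} := by ext; simp
  rw [hU]
  refine (measure_iUnion_le _).trans (le_of_eq ?_)
  simp only [hE]
  rw [ENNReal.tsum_mul_right, ENNReal.tsum_geometric,
    ENNReal.sub_sub_cancel one_ne_top prob_le_one, mul_comm, div_eq_mul_inv]

theorem infinitePi_never_hit {S : Set E} (hS : MeasurableSet S) (h0 : μ S ≠ 0) :
    Measure.infinitePi (fun _ : ℕ => μ) {ω | ∀ k, ω k ∉ S} = 0 := by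
  have hle : ∀ k : ℕ, Measure.infinitePi (fun _ : ℕ => μ) {ω | ∀ k, ω k ∉ S} ≤ (1 - μ S) ^ k := by
    intro k
    calc _ ≤ Measure.infinitePi (fun _ : ℕ => μ) (Set.pi (Finset.range k) fun _ => Sᶜ) :=
          measure_mono fun ω (hω : ∀ k, ω k ∉ S) i _ => hω i
      _ = _ := by
          rw [Measure.infinitePi_pi _ (fun _ _ => hS.compl), Finset.prod_const, Finset.card_range,
            prob_compl_eq_one_sub hS]
  refine le_antisymm (ge_of_tendsto' (ENNReal.tendsto_pow_atTop_nhds_zero_of_lt_one ?_) hle) zero_le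
  exact ENNReal.sub_lt_self one_ne_top one_ne_zero h0

end Rejection

section Sampler

variable (b : ℕ)

/-- The law of a uniformly random letter together with an independent uniform height. -/
def proposal : Measure (Fin b × ℝ) := ((b : ℝ≥0∞)⁻¹ • Measure.count).prod stdSpace

instance [NeZero b] : IsProbabilityMeasure ((b : ℝ≥0∞)⁻¹ • Measure.count : Measure (Fin b)) :=
  ⟨by simp [Measure.count_univ, ENNReal.inv_mul_cancel (Nat.cast_ne_zero.2 (NeZero.ne b))]⟩

instance [NeZero b] : IsProbabilityMeasure (proposal b) := by
  unfold proposal; infer_instance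

variable {b}

theorem proposal_apply [NeZero b] {s : Set (Fin b × ℝ)} (hs : MeasurableSet s) :
    proposal b s = (b : ℝ≥0∞)⁻¹ * ∑ a, stdSpace {r | (a, r) ∈ s} := by
  rw [proposal, Measure.prod_apply hs, lintegral_smul_measure, lintegral_count, tsum_fintype]
  rfl

theorem stdSpace_ofReal_mem_Ico_le (c c' : ℝ≥0∞) (hc : c ≠ ⊤) :
    stdSpace {r | c' ≤ ENNReal.ofReal r ∧ ENNReal.ofReal r < c} ≤ c - c' := by
  rcases eq_or_ne c' ⊤ with rfl | hc'
  · simp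
  rw [stdSpace, Measure.restrict_apply' measurableSet_Icc]
  calc _ ≤ volume (Set.Ico c'.toReal c.toReal) := by
        refine measure_mono ?_
        rintro r ⟨⟨h1, h2⟩, h3⟩
        exact ⟨ENNReal.toReal_le_of_le_ofReal h3.1 h1,
            (ENNReal.ofReal_lt_iff_lt_toReal h3.1 hc).1 h2⟩
    _ = c - c' := by
        rw [Real.volume_Ico, ENNReal.ofReal_sub _ ENNReal.toReal_nonneg, ENNReal.ofReal_toReal hc,
          ENNReal.ofReal_toReal hc']

theorem le_stdSpace_ofReal_lt {c : ℝ≥0∞} (hc : c ≤ 1) :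
    c ≤ stdSpace {r | ENNReal.ofReal r < c} := by
  have hct : c ≠ ⊤ := ne_top_of_le_ne_top one_ne_top hc
  calc c = volume (Set.Ico 0 c.toReal) := by
        rw [Real.volume_Ico, sub_zero, ENNReal.ofReal_toReal hct]
    _ ≤ _ := by
        rw [stdSpace, Measure.restrict_apply' measurableSet_Icc]
        refine measure_mono ?_
        rintro r ⟨h1, h2⟩
        refine ⟨(ENNReal.ofReal_lt_iff_lt_toReal h1 hct).2 h2, h1, h2.le.trans ?_⟩
        exact ENNReal.toReal_le_of_le_ofReal zero_le_one (by simpa using hc)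

/-- The index of the first proposal lying under the graph of `p`. -/
def acceptTime (p : Fin b → ℝ≥0∞) (ω : ℕ → Fin b × ℝ) : ℕ :=
  sInf {n | ENNReal.ofReal (ω n).2 < p (ω n).1}

/-- Rejection sampling: the letter of the first proposal lying under the graph of `p`. -/
def rejectionSample (p : Fin b → ℝ≥0∞) (ω : ℕ → Fin b × ℝ) : Fin b := (ω (acceptTime p ω)).1

theorem measurableSet_accept (n : ℕ) : MeasurableSet
    {z : (Fin b → ℝ≥0∞) × (ℕ → Fin b × ℝ) | ENNReal.ofReal (z.2 n).2 < z.1 (z.2 n).1} := by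
  have h1 : Measurable fun z : (Fin b → ℝ≥0∞) × (ℕ → Fin b × ℝ) => z.2 n :=
    (measurable_pi_apply n).comp measurable_snd
  have h2 : Measurable fun w : (Fin b → ℝ≥0∞) × Fin b => w.1 w.2 :=
    measurable_from_prod_countable_left fun a => measurable_pi_apply a
  exact measurableSet_lt (measurable_snd.comp h1).ennreal_ofReal
    (h2.comp (measurable_fst.prodMk (measurable_fst.comp h1)))

theorem measurable_acceptTime : Measurable
    fun z : (Fin b → ℝ≥0∞) × (ℕ → Fin b × ℝ) => acceptTime z.1 z.2 := by
  refine measurable_of_Iic fun m => ?_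
  have : (fun z : (Fin b → ℝ≥0∞) × (ℕ → Fin b × ℝ) => acceptTime z.1 z.2) ⁻¹' Set.Iic m =
      (⋃ n ∈ Set.Iic m, {z | ENNReal.ofReal (z.2 n).2 < z.1 (z.2 n).1}) ∪
      ⋂ n, {z | ENNReal.ofReal (z.2 n).2 < z.1 (z.2 n).1}ᶜ := by
    ext z
    simp only [Set.mem_preimage, Set.mem_Iic, Set.mem_union, Set.mem_iUnion, Set.mem_iInter,
      Set.mem_ofPred_eq, Set.mem_compl_iff, exists_prop]
    constructor
    · intro h
      by_cases hne : {n | ENNReal.ofReal (z.2 n).2 < z.1 (z.2 n).1}.Nonempty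
      · exact Or.inl ⟨_, h, Nat.sInf_mem hne⟩
      · exact Or.inr fun n hn => hne ⟨n, hn⟩
    · rintro (⟨n, hn, hz⟩ | h)
      · exact (Nat.sInf_le hz).trans hn
      · have : {n | ENNReal.ofReal (z.2 n).2 < z.1 (z.2 n).1} = ∅ :=
          Set.eq_empty_of_forall_notMem h
        simp [acceptTime, this]
  rw [this]
  exact (MeasurableSet.biUnion (Set.to_countable _) fun n _ => measurableSet_accept n).union
    (MeasurableSet.iInter fun n => (measurableSet_accept n).compl)

theorem measurable_rejectionSample : Measurable
    fun z : (Fin b → ℝ≥0∞) × (ℕ → Fin b × ℝ) => rejectionSample z.1 z.2 := by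
  have h : Measurable fun w : (ℕ → Fin b × ℝ) × ℕ => w.1 w.2 :=
    measurable_from_prod_countable_left fun n => measurable_pi_apply n
  exact measurable_fst.comp (h.comp (measurable_snd.prodMk measurable_acceptTime))

theorem measurableSet_under (p : Fin b → ℝ≥0∞) :
    MeasurableSet {z : Fin b × ℝ | ENNReal.ofReal z.2 < p z.1} :=
  measurableSet_lt measurable_snd.ennreal_ofReal ((measurable_of_countable p).comp measurable_fst)

/-- The law of the sequence of independent proposals. -/
def proposals (b : ℕ) [NeZero b] : Measure (ℕ → Fin b × ℝ) :=
  Measure.infinitePi fun _ => proposal b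

instance [NeZero b] : IsProbabilityMeasure (proposals b) := by
  unfold proposals; infer_instance

theorem inv_le_proposal_under [NeZero b] {p : Fin b → ℝ≥0∞} (hp : ∑ a, p a = 1) :
    (b : ℝ≥0∞)⁻¹ ≤ proposal b {z | ENNReal.ofReal z.2 < p z.1} := by
  rw [proposal_apply (measurableSet_under p)]
  calc (b : ℝ≥0∞)⁻¹ = (b : ℝ≥0∞)⁻¹ * ∑ a, p a := by rw [hp, mul_one]
    _ ≤ _ := by
        gcongr with a
        exact le_stdSpace_ofReal_lt (hp ▸ Finset.single_le_sum (fun _ _ => zero_le)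
            (Finset.mem_univ a))

theorem le_inv_mul_of_div [NeZero b] {s t c : ℝ≥0∞} (hs : (b : ℝ≥0∞)⁻¹ ≤ s)
    (ht : t ≤ (b : ℝ≥0∞)⁻¹ * c) : t / s ≤ c := by
  have hb : (b : ℝ≥0∞) ≠ 0 := Nat.cast_ne_zero.2 (NeZero.ne b)
  calc t / s ≤ ((b : ℝ≥0∞)⁻¹ * c) / (b : ℝ≥0∞)⁻¹ := ENNReal.div_le_div ht hs
    _ = c := by
        rw [div_eq_mul_inv, inv_inv, mul_comm, ← mul_assoc,
          ENNReal.mul_inv_cancel hb (ENNReal.natCast_ne_top b), one_mul]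

theorem proposals_rejectionSample_le [NeZero b] {p : Fin b → ℝ≥0∞} (hp : ∑ a, p a = 1)
    (a : Fin b) : proposals b {ω | rejectionSample p ω = a} ≤ p a := by
  have hpa : ∀ a, p a ≠ ⊤ := fun a => ne_top_of_le_ne_top one_ne_top
    (hp ▸ Finset.single_le_sum (fun _ _ => zero_le) (Finset.mem_univ a))
  have hs := inv_le_proposal_under hp
  have hs0 : proposal b {z | ENNReal.ofReal z.2 < p z.1} ≠ 0 :=
    (lt_of_lt_of_le (ENNReal.inv_pos.2 (ENNReal.natCast_ne_top b)) hs).ne'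
  have hB : MeasurableSet ({z : Fin b × ℝ | ENNReal.ofReal z.2 < p z.1} ∩ {z | z.1 = a}) :=
    (measurableSet_under p).inter (measurable_fst (measurableSet_singleton a))
  calc proposals b {ω | rejectionSample p ω = a}
      ≤ proposals b ({ω | ∃ k, (∀ i < k, ω i ∉ {z | ENNReal.ofReal z.2 < p z.1}) ∧
          ω k ∈ {z : Fin b × ℝ | ENNReal.ofReal z.2 < p z.1} ∩ {z | z.1 = a}} ∪
          {ω | ∀ k, ω k ∉ {z : Fin b × ℝ | ENNReal.ofReal z.2 < p z.1}}) := by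
        refine measure_mono fun ω hω => ?_
        by_cases hne : {n | ENNReal.ofReal (ω n).2 < p (ω n).1}.Nonempty
        · exact Or.inl ⟨acceptTime p ω, fun i hi => Nat.notMem_of_lt_sInf hi, Nat.sInf_mem hne, hω⟩
        · exact Or.inr fun n hn => hne ⟨n, hn⟩
    _ ≤ _ := measure_union_le _ _
    _ ≤ p a + 0 := by
        refine add_le_add ((infinitePi_first_hit_le _ (measurableSet_under p) hB).trans
          (le_inv_mul_of_div hs ?_))
          (infinitePi_never_hit _ (measurableSet_under p) hs0).le
        rw [proposal_apply hB]
        gcongr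
        rw [Finset.sum_eq_single a]
        · refine (measure_mono ?_).trans ((stdSpace_ofReal_mem_Ico_le (p a) 0 (hpa a)).trans
            (by simp))
          exact fun r hr => ⟨zero_le, hr.1⟩
        · intro c _ hc
          have : {r : ℝ | (c, r) ∈ {z : Fin b × ℝ | ENNReal.ofReal z.2 < p z.1} ∩ {z | z.1 = a}} =
              ∅ :=
            Set.eq_empty_of_forall_notMem fun r hr => hc hr.2
          rw [this, measure_empty]
        · simp
    _ = p a := add_zero _

theorem proposals_rejectionSample_eq [NeZero b] {p : Fin b → ℝ≥0∞} (hp : ∑ a, p a = 1)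
    (a : Fin b) : proposals b {ω | rejectionSample p ω = a} = p a := by
  have hm : Measurable (rejectionSample p) :=
    measurable_rejectionSample.comp (measurable_prodMk_left (x := p))
  have hsum : ∑ a, proposals b {ω | rejectionSample p ω = a} = 1 := by
    have := sum_measure_preimage_singleton (μ := proposals b) Finset.univ
      (f := rejectionSample p) (fun y _ => hm (measurableSet_singleton y))
    exact this.trans (by simp)
  refine le_antisymm (proposals_rejectionSample_le hp a) ?_
  have hfin : ∑ c ∈ Finset.univ.erase a, p c ≠ ⊤ := ne_top_of_le_ne_top one_ne_top
    (hp ▸ Finset.sum_le_sum_of_subset (Finset.erase_subset a Finset.univ))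
  refine (ENNReal.add_le_add_iff_right hfin).1 ?_
  rw [Finset.add_sum_erase _ _ (Finset.mem_univ a), hp, ← hsum,
    ← Finset.add_sum_erase _ _ (Finset.mem_univ a)]
  gcongr
  exact proposals_rejectionSample_le hp _

theorem proposals_rejectionSample_ne_le [NeZero b] {p p' : Fin b → ℝ≥0∞} (hp : ∑ a, p a = 1)
    (hp' : ∑ a, p' a = 1) :
    proposals b {ω | rejectionSample p ω ≠ rejectionSample p' ω} ≤
      ∑ a, (p a - p' a) + ∑ a, (p' a - p a) := by
  have htop : ∀ {p : Fin b → ℝ≥0∞}, ∑ a, p a = 1 → ∀ a, p a ≠ ⊤ :=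
    fun hp a => ne_top_of_le_ne_top one_ne_top
      (hp ▸ Finset.single_le_sum (fun _ _ => zero_le) (Finset.mem_univ a))
  set U : Set (Fin b × ℝ) := {z | ENNReal.ofReal z.2 < p z.1} with hU
  set U' : Set (Fin b × ℝ) := {z | ENNReal.ofReal z.2 < p' z.1} with hU'
  have hs : (b : ℝ≥0∞)⁻¹ ≤ proposal b (U ∪ U') :=
    (inv_le_proposal_under hp).trans (measure_mono Set.subset_union_left)
  have hs0 : proposal b (U ∪ U') ≠ 0 :=
    (lt_of_lt_of_le (ENNReal.inv_pos.2 (ENNReal.natCast_ne_top b)) hs).ne'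
  have hB : MeasurableSet (symmDiff U U') :=
      (measurableSet_under p).symmDiff (measurableSet_under p')
  have hS : MeasurableSet (U ∪ U') := (measurableSet_under p).union (measurableSet_under p')
  calc proposals b {ω | rejectionSample p ω ≠ rejectionSample p' ω}
      ≤ proposals b ({ω | ∃ k, (∀ i < k, ω i ∉ U ∪ U') ∧ ω k ∈ symmDiff U U'} ∪
          {ω | ∀ k, ω k ∉ U ∪ U'}) := by
        refine measure_mono fun ω hω => ?_
        by_cases hne : {n | ω n ∈ U ∪ U'}.Nonempty
        · refine Or.inl ⟨sInf {n | ω n ∈ U ∪ U'}, fun i hi => Nat.notMem_of_lt_sInf hi, ?_⟩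
          set k := sInf {n | ω n ∈ U ∪ U'} with hk
          have hmem : ω k ∈ U ∪ U' := Nat.sInf_mem hne
          by_contra hsd
          have hboth : ω k ∈ U ∧ ω k ∈ U' := by
            simp only [Set.mem_symmDiff, Set.mem_union] at hsd hmem; tauto
          have h1 : acceptTime p ω = k := le_antisymm (Nat.sInf_le hboth.1)
            (Nat.sInf_le (Or.inl (Nat.sInf_mem (s := {n | ω n ∈ U}) ⟨k, hboth.1⟩)))
          have h2 : acceptTime p' ω = k := le_antisymm (Nat.sInf_le hboth.2)
            (Nat.sInf_le (Or.inr (Nat.sInf_mem (s := {n | ω n ∈ U'}) ⟨k, hboth.2⟩)))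
          exact hω (by simp only [rejectionSample, h1, h2])
        · exact Or.inr fun n hn => hne ⟨n, hn⟩
    _ ≤ _ := measure_union_le _ _
    _ ≤ (∑ a, (p a - p' a) + ∑ a, (p' a - p a)) + 0 := by
        refine add_le_add ((infinitePi_first_hit_le _ hS hB).trans
          (le_inv_mul_of_div hs ?_)) (infinitePi_never_hit _ hS hs0).le
        rw [proposal_apply hB, ← Finset.sum_add_distrib]
        gcongr with a
        refine le_trans (measure_mono (t := {r | p' a ≤ ENNReal.ofReal r ∧ ENNReal.ofReal r < p a} ∪
          {r | p a ≤ ENNReal.ofReal r ∧ ENNReal.ofReal r < p' a}) ?_) ((measure_union_le _ _).trans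
          (add_le_add (stdSpace_ofReal_mem_Ico_le _ _ (htop hp a))
            (stdSpace_ofReal_mem_Ico_le _ _ (htop hp' a))))
        rintro r (⟨h1, h2⟩ | ⟨h1, h2⟩)
        · exact Or.inl ⟨not_lt.1 h2, h1⟩
        · exact Or.inr ⟨not_lt.1 h2, h1⟩
    _ = _ := add_zero _

end Sampler

theorem infinitePi_inter_eval {E : Type*} [MeasurableSpace E] (μ : Measure E)
    [IsProbabilityMeasure μ] (j : ℕ) {A : Set (ℕ → E)} (hA : MeasurableSet A)
    (hdep : ∀ ω ω' : ℕ → E, (∀ i < j, ω i = ω' i) → ω ∈ A → ω' ∈ A) {B : Set E}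
    (hB : MeasurableSet B) :
    Measure.infinitePi (fun _ => μ) (A ∩ {ω | ω j ∈ B}) =
      Measure.infinitePi (fun _ => μ) A * μ B := by
  obtain ⟨e⟩ : Nonempty E := μ.nonempty_of_neZero
  have hind : ProbabilityTheory.iIndepFun (fun (i : ℕ) (ω : ℕ → E) => ω i)
      (Measure.infinitePi fun _ => μ) :=
    ProbabilityTheory.iIndepFun_infinitePi (X := fun _ => id) fun _ => measurable_id
  have h2 := hind.indepFun_finset (Finset.range j) {j} (by simp) fun i => measurable_pi_apply i
  let ext : (Finset.range j → E) → ℕ → E := fun x i =>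
    if h : i ∈ Finset.range j then x ⟨i, h⟩ else e
  have hext : Measurable ext := by
    refine measurable_pi_lambda _ fun i => ?_
    by_cases h : i ∈ Finset.range j
    · simp only [ext, h, dite_true]; exact measurable_pi_apply _
    · simp only [ext, h, dite_false]; exact measurable_const
  have hAeq : A = (fun ω (i : Finset.range j) => ω i) ⁻¹' (ext ⁻¹' A) := by
    ext ω
    constructor
    · exact hdep _ _ fun i hi => by simp [ext, hi]
    · exact hdep _ _ fun i hi => by simp [ext, hi]
  have hBeq : {ω : ℕ → E | ω j ∈ B} = (fun ω (i : ({j} : Finset ℕ)) => ω i) ⁻¹'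
      ((fun x => x ⟨j, Finset.mem_singleton_self j⟩) ⁻¹' B) := rfl
  have h3 := h2.measure_inter_preimage_eq_mul _ _ (hext hA)
    (measurable_pi_apply (⟨j, Finset.mem_singleton_self j⟩ : ({j} : Finset ℕ)) hB)
  rw [← hAeq, ← hBeq] at h3
  rw [h3]
  congr 1
  change Measure.infinitePi (fun _ => μ) ((fun ω => ω j) ⁻¹' B) = μ B
  rw [← Measure.map_apply (measurable_pi_apply j) hB, Measure.infinitePi_map_eval]

section Chain

variable (b : ℕ)

/-- The index of the `b`-adic arc of length `b ^ (-j)` containing `x`. -/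
def arcIndex (j : ℕ) (x : AddCircle (1 : ℝ)) : ℕ := ⌊(b : ℝ) ^ j * circleRep x⌋₊

theorem measurable_arcIndex (j : ℕ) : Measurable (arcIndex b j) :=
  Nat.measurable_floor.comp (measurable_circleRep.const_mul _)

theorem arcIndex_zero (x : AddCircle (1 : ℝ)) : arcIndex b 0 x = 0 := by
  simp [arcIndex, circleRep_lt_one]

variable {b}

theorem arcIndex_succ_div [NeZero b] (j : ℕ) (x : AddCircle (1 : ℝ)) :
    arcIndex b (j + 1) x / b = arcIndex b j x := by
  have hb : (b : ℝ) ≠ 0 := Nat.cast_ne_zero.2 (NeZero.ne b)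
  rw [arcIndex, arcIndex, ← Nat.floor_div_natCast]
  congr 1
  rw [pow_succ]
  field_simp

variable (b)

/-- The conditional distribution of the next `b`-adic digit of a `P`-random point, given that it
lies in the `k`-th arc of generation `j`. -/
def digitLaw (P : Measure (AddCircle (1 : ℝ))) (j k : ℕ) (a : Fin b) : ℝ≥0∞ :=
  P {x | arcIndex b (j + 1) x = b * k + a} / P {x | arcIndex b j x = k}

/-- The random sequence of nested `b`-adic arcs, each digit being drawn by rejection sampling. -/
def arcChain (P : Measure (AddCircle (1 : ℝ))) (ω : ℕ → ℕ → Fin b × ℝ) : ℕ → ℕ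
  | 0 => 0
  | j + 1 => b * arcChain P ω j + rejectionSample (digitLaw b P j (arcChain P ω j)) (ω j)

/-- The law of the source of randomness of `arcChain`. -/
def chainSource [NeZero b] : Measure (ℕ → ℕ → Fin b × ℝ) :=
  Measure.infinitePi fun _ => proposals b

instance [NeZero b] : IsProbabilityMeasure (chainSource b) := by
  unfold chainSource; infer_instance

variable {b}

theorem measurableSet_arcIndex_eq (j k : ℕ) : MeasurableSet {x | arcIndex b j x = k} :=
  measurable_arcIndex b j (measurableSet_singleton k)

theorem measurable_arcChain
    (κ : ProbabilityTheory.Kernel (AddCircle (1 : ℝ)) (AddCircle (1 : ℝ))) (j : ℕ) :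
    Measurable fun z : AddCircle (1 : ℝ) × (ℕ → ℕ → Fin b × ℝ) => arcChain b (κ z.1) z.2 j := by
  induction j with
  | zero => exact measurable_const
  | succ j ih =>
    have h1 : Measurable fun w : AddCircle (1 : ℝ) × ℕ => digitLaw b (κ w.1) j w.2 := by
      refine measurable_from_prod_countable_left fun k => measurable_pi_lambda _ fun a => ?_
      exact Measurable.div (κ.measurable_coe (measurableSet_arcIndex_eq (j + 1) (b * k + a)))
        (κ.measurable_coe (measurableSet_arcIndex_eq j k))
    have h2 : Measurable fun z : AddCircle (1 : ℝ) × (ℕ → ℕ → Fin b × ℝ) =>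
        rejectionSample (digitLaw b (κ z.1) j (arcChain b (κ z.1) z.2 j)) (z.2 j) :=
      measurable_rejectionSample.comp ((h1.comp (measurable_fst.prodMk ih)).prodMk
        ((measurable_pi_apply j).comp measurable_snd))
    exact (ih.const_mul b).add ((measurable_of_countable (fun a : Fin b => (a : ℕ))).comp h2)

theorem measurable_arcChain_apply (P : Measure (AddCircle (1 : ℝ))) (j : ℕ) :
    Measurable fun ω => arcChain b P ω j :=
  (measurable_arcChain (ProbabilityTheory.Kernel.const _ P) j).comp
    (measurable_prodMk_left (x := (0 : AddCircle (1 : ℝ))))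

theorem arcChain_congr (P : Measure (AddCircle (1 : ℝ))) {ω ω' : ℕ → ℕ → Fin b × ℝ} (j : ℕ)
    (h : ∀ i < j, ω i = ω' i) : arcChain b P ω j = arcChain b P ω' j := by
  induction j with
  | zero => rfl
  | succ j ih =>
    simp only [arcChain]
    rw [ih fun i hi => h i (by omega), h j (by omega)]

theorem sum_measure_arcIndex_succ [NeZero b] (P : Measure (AddCircle (1 : ℝ))) (j k : ℕ) :
    ∑ a : Fin b, P {x | arcIndex b (j + 1) x = b * k + a} = P {x | arcIndex b j x = k} := by
  have hb : 0 < b := Nat.pos_of_ne_zero (NeZero.ne b)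
  have hset : {x | arcIndex b j x = k} =
      ⋃ a ∈ (Finset.univ : Finset (Fin b)), {x | arcIndex b (j + 1) x = b * k + a} := by
    ext x
    simp only [Set.mem_ofPred_eq, Finset.mem_univ, Set.iUnion_true, Set.mem_iUnion]
    rw [← arcIndex_succ_div j x]
    constructor
    · intro h
      exact ⟨⟨arcIndex b (j + 1) x % b, Nat.mod_lt _ hb⟩, by simp [← h, Nat.div_add_mod]⟩
    · rintro ⟨a, ha⟩
      rw [ha, Nat.mul_add_div hb, Nat.div_eq_of_lt a.2, add_zero]
  rw [hset, measure_biUnion_finset _ fun a _ => measurableSet_arcIndex_eq _ _]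
  intro a _ c _ hac
  refine Set.disjoint_left.2 fun x hx hx' => hac (Fin.ext ?_)
  have := hx.symm.trans hx'
  simpa using this

theorem sum_digitLaw [NeZero b] (P : Measure (AddCircle (1 : ℝ))) [IsProbabilityMeasure P]
    {j k : ℕ} (h : P {x | arcIndex b j x = k} ≠ 0) : ∑ a, digitLaw b P j k a = 1 := by
  simp only [digitLaw, div_eq_mul_inv]
  rw [← Finset.sum_mul, sum_measure_arcIndex_succ, ENNReal.mul_inv_cancel h (measure_ne_top _ _)]

theorem chainSource_arcChain_eq [NeZero b] (P : Measure (AddCircle (1 : ℝ)))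
    [IsProbabilityMeasure P] (j k : ℕ) :
    chainSource b {ω | arcChain b P ω j = k} = P {x | arcIndex b j x = k} := by
  induction j generalizing k with
  | zero =>
    rcases eq_or_ne k 0 with rfl | hk
    · simp [arcChain, arcIndex_zero]
    · simp [arcChain, arcIndex_zero, hk.symm]
  | succ j ih =>
    have hb : 0 < b := Nat.pos_of_ne_zero (NeZero.ne b)
    obtain ⟨l, a, rfl⟩ : ∃ (l : ℕ) (a : Fin b), k = b * l + a :=
      ⟨k / b, ⟨k % b, Nat.mod_lt _ hb⟩, (Nat.div_add_mod k b).symm⟩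
    have hset : {ω | arcChain b P ω (j + 1) = b * l + a} = {ω | arcChain b P ω j = l} ∩
        {ω | ω j ∈ {η | rejectionSample (digitLaw b P j l) η = a}} := by
      ext ω
      simp only [Set.mem_ofPred_eq, Set.mem_inter_iff, arcChain]
      constructor
      · intro h
        have h1 : arcChain b P ω j = l := by
          have := congrArg (· / b) h
          simpa [Nat.mul_add_div hb, Nat.div_eq_of_lt] using this
        refine ⟨h1, Fin.ext ?_⟩
        rw [h1] at h; omega
      · rintro ⟨rfl, rfl⟩; rfl
    have hm : MeasurableSet {η | rejectionSample (digitLaw b P j l) η = a} :=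
      (measurable_rejectionSample.comp (measurable_prodMk_left (x := digitLaw b P j l)))
        (measurableSet_singleton a)
    have hA : MeasurableSet {ω | arcChain b P ω j = l} :=
      measurable_arcChain_apply P j (measurableSet_singleton l)
    rw [hset, chainSource, infinitePi_inter_eval _ j hA
      (fun ω ω' h hω => (arcChain_congr P j h).symm.trans hω) hm]
    change chainSource b {ω | arcChain b P ω j = l} * _ = _
    rw [ih]
    by_cases h0 : P {x | arcIndex b j x = l} = 0
    · have := sum_measure_arcIndex_succ (b := b) P j l
      rw [h0, Finset.sum_eq_zero_iff] at this
      rw [h0, zero_mul, this a (Finset.mem_univ a)]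
    · rw [proposals_rejectionSample_eq (sum_digitLaw P h0), digitLaw,
        ENNReal.mul_div_cancel h0 (measure_ne_top _ _)]

end Chain

theorem mul_sum_div_sub_div_le {ι : Type*} [Fintype ι] (A B : ι → ℝ≥0∞) {α β m : ℝ≥0∞}
    (hA : ∑ a, A a = α) (hB : ∑ a, B a = β) (hα : α ≠ ⊤) (hβ : β ≠ ⊤) (hα0 : α ≠ 0)
    (hαβ : α ≤ β) (hm : m ≤ α) :
    m * (∑ a, (A a / α - B a / β) + ∑ a, (B a / β - A a / α)) ≤ 2 * ∑ a, (B a - A a) := by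
  have hβ0 : β ≠ 0 := fun h => hα0 (le_antisymm (h ▸ hαβ) zero_le)
  have hp : ∑ a, A a / α = 1 := by
    simp only [div_eq_mul_inv]
    rw [← Finset.sum_mul, hA, ENNReal.mul_inv_cancel hα0 hα]
  have hp' : ∑ a, B a / β = 1 := by
    simp only [div_eq_mul_inv]
    rw [← Finset.sum_mul, hB, ENNReal.mul_inv_cancel hβ0 hβ]
  have heq : ∑ a, (A a / α - B a / β) = ∑ a, (B a / β - A a / α) := by
    have h1 : ∑ a, (A a / α - B a / β) + ∑ a, B a / β =
        ∑ a, (B a / β - A a / α) + ∑ a, A a / α := by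
      rw [← Finset.sum_add_distrib, ← Finset.sum_add_distrib]
      refine Finset.sum_congr rfl fun a _ => ?_
      rw [tsub_add_eq_max, tsub_add_eq_max, max_comm]
    rw [hp, hp'] at h1
    exact (ENNReal.add_left_inj one_ne_top).1 h1
  rw [heq, ← two_mul, mul_left_comm]
  gcongr
  rw [Finset.mul_sum]
  gcongr with a
  calc m * (B a / β - A a / α) ≤ α * (B a / β - A a / α) := by gcongr
    _ = α * (B a / β) - α * (A a / α) := ENNReal.mul_sub fun _ _ => hα
    _ ≤ B a - A a := by
        rw [ENNReal.mul_div_cancel hα0 hα]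
        gcongr
        calc α * (B a / β) ≤ β * (B a / β) := by gcongr
          _ = B a := ENNReal.mul_div_cancel hβ0 hβ

theorem sum_measure_sub_measure_le {Z : Type*} [MeasurableSpace Z] (γ : Measure Z)
    {f g : Z → ℕ} (hf : Measurable f) (hg : Measurable g) {b : ℕ} (hb : 0 < b) (k : ℕ) :
    ∑ a : Fin b, (γ {z | g z = b * k + a} - γ {z | f z = b * k + a}) ≤
      γ {z | g z / b = k ∧ f z ≠ g z} := by
  have hfm : ∀ n, MeasurableSet {z | f z = n} := fun n => hf (measurableSet_singleton n)
  have hgm : ∀ n, MeasurableSet {z | g z = n} := fun n => hg (measurableSet_singleton n)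
  calc _ ≤ ∑ a : Fin b, γ ({z | g z = b * k + a} ∩ {z | f z = b * k + a}ᶜ) := by
        gcongr with a
        rw [tsub_le_iff_right]
        refine (measure_mono fun z hz => ?_).trans (measure_union_le _ _)
        by_cases h : z ∈ {z | f z = b * k + a}
        · exact Or.inr h
        · exact Or.inl ⟨hz, h⟩
    _ = γ (⋃ a ∈ (Finset.univ : Finset (Fin b)),
          {z | g z = b * k + a} ∩ {z | f z = b * k + a}ᶜ) := by
        rw [measure_biUnion_finset _ fun a _ => (hgm _).inter (hfm _).compl]
        intro a _ c _ hac
        refine Set.disjoint_left.2 fun x hx hx' => hac (Fin.ext ?_)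
        have := hx.1.symm.trans hx'.1
        simpa using this
    _ ≤ _ := by
        refine measure_mono fun z hz => ?_
        simp only [Finset.mem_univ, Set.iUnion_true, Set.mem_iUnion] at hz
        obtain ⟨a, ha, hfa⟩ := hz
        refine ⟨?_, fun h => hfa (h.trans ha)⟩
        rw [show g z = b * k + a from ha, Nat.mul_add_div hb, Nat.div_eq_of_lt a.2, add_zero]

section Chain

variable {b : ℕ}

variable (b) in
/-- The pairs of points separated by the `b`-adic arcs of generation `j`. -/
def separated (j : ℕ) : Set (AddCircle (1 : ℝ) × AddCircle (1 : ℝ)) :=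
  {z | arcIndex b j z.1 ≠ arcIndex b j z.2}

theorem measurableSet_separated (j : ℕ) : MeasurableSet (separated b j) :=
  (measurableSet_eq_fun ((measurable_arcIndex b j).comp measurable_fst)
    ((measurable_arcIndex b j).comp measurable_snd)).compl

theorem separated_zero : separated b 0 = ∅ := by
  ext z; simp [separated, arcIndex_zero]

theorem tsum_measure_eq_inter_le {Z : Type*} [MeasurableSpace Z] (γ : Measure Z)
    {f : Z → ℕ} (hf : Measurable f) {S : Set Z} (hS : MeasurableSet S) :
    ∑' k, γ ({z | f z = k} ∩ S) ≤ γ S := by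
  refine (tsum_meas_le_meas_iUnion_of_disjoint γ
    (fun k => (hf (measurableSet_singleton k)).inter hS) fun k l hkl => ?_).trans
    (measure_mono (Set.iUnion_subset fun k => Set.inter_subset_right))
  exact Set.disjoint_left.2 fun z hz hz' => hkl (hz.1.symm.trans hz'.1)

theorem chainSource_split_le [NeZero b]
    (γ : Measure (AddCircle (1 : ℝ) × AddCircle (1 : ℝ))) [IsProbabilityMeasure γ] (j k : ℕ) :
    chainSource b {ω | arcChain b (γ.map Prod.fst) ω j = k ∧ arcChain b (γ.map Prod.snd) ω j = k ∧
        arcChain b (γ.map Prod.fst) ω (j + 1) ≠ arcChain b (γ.map Prod.snd) ω (j + 1)} ≤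
      2 * (γ ({z | arcIndex b j z.1 = k} ∩ separated b (j + 1)) +
        γ ({z | arcIndex b j z.2 = k} ∩ separated b j)) := by
  have hb : 0 < b := Nat.pos_of_ne_zero (NeZero.ne b)
  have : IsProbabilityMeasure (γ.map Prod.fst) :=
    Measure.isProbabilityMeasure_map measurable_fst.aemeasurable
  have : IsProbabilityMeasure (γ.map Prod.snd) :=
    Measure.isProbabilityMeasure_map measurable_snd.aemeasurable
  set P := γ.map Prod.fst with hP
  set Q := γ.map Prod.snd with hQ
  have hPi : ∀ i n, P {x | arcIndex b i x = n} = γ {z | arcIndex b i z.1 = n} := fun i n =>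
    Measure.map_apply measurable_fst (measurableSet_arcIndex_eq i n)
  have hQi : ∀ i n, Q {x | arcIndex b i x = n} = γ {z | arcIndex b i z.2 = n} := fun i n =>
    Measure.map_apply measurable_snd (measurableSet_arcIndex_eq i n)
  set A : Set (ℕ → ℕ → Fin b × ℝ) := {ω | arcChain b P ω j = k} ∩ {ω | arcChain b Q ω j = k} with hA
  set m := chainSource b A with hmdef
  have hAm : MeasurableSet A :=
    (measurable_arcChain_apply P j (measurableSet_singleton k)).inter
      (measurable_arcChain_apply Q j (measurableSet_singleton k))
  have hmP : m ≤ P {x | arcIndex b j x = k} := by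
    rw [← chainSource_arcChain_eq P j k]; exact measure_mono Set.inter_subset_left
  have hmQ : m ≤ Q {x | arcIndex b j x = k} := by
    rw [← chainSource_arcChain_eq Q j k]; exact measure_mono Set.inter_subset_right
  have hset : {ω | arcChain b P ω j = k ∧ arcChain b Q ω j = k ∧
      arcChain b P ω (j + 1) ≠ arcChain b Q ω (j + 1)} = A ∩ {ω | ω j ∈
        {η | rejectionSample (digitLaw b P j k) η ≠ rejectionSample (digitLaw b Q j k) η}} := by
    ext ω
    simp only [hA, Set.mem_ofPred_eq, Set.mem_inter_iff, arcChain]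
    constructor
    · rintro ⟨h1, h2, h3⟩
      refine ⟨⟨h1, h2⟩, fun h => h3 ?_⟩
      rw [h1, h2, h]
    · rintro ⟨⟨h1, h2⟩, h3⟩
      refine ⟨h1, h2, fun h => h3 (Fin.ext ?_)⟩
      rw [h1, h2] at h
      omega
  have hBm : MeasurableSet
      {η | rejectionSample (digitLaw b P j k) η ≠ rejectionSample (digitLaw b Q j k) η} :=
    (measurableSet_eq_fun
      (measurable_rejectionSample.comp (measurable_prodMk_left (x := digitLaw b P j k)))
      (measurable_rejectionSample.comp (measurable_prodMk_left (x := digitLaw b Q j k)))).compl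
  have hprod : chainSource b (A ∩ {ω | ω j ∈
        {η | rejectionSample (digitLaw b P j k) η ≠ rejectionSample (digitLaw b Q j k) η}}) =
      m * proposals b
        {η | rejectionSample (digitLaw b P j k) η ≠ rejectionSample (digitLaw b Q j k) η} :=
    infinitePi_inter_eval _ j hAm (fun ω ω' h hω =>
      ⟨(arcChain_congr P j h).symm.trans hω.1, (arcChain_congr Q j h).symm.trans hω.2⟩) hBm
  rw [hset, hprod]
  by_cases hP0 : P {x | arcIndex b j x = k} = 0
  · rw [show m = 0 from le_antisymm (hP0 ▸ hmP) zero_le, zero_mul]; exact zero_le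
  by_cases hQ0 : Q {x | arcIndex b j x = k} = 0
  · rw [show m = 0 from le_antisymm (hQ0 ▸ hmQ) zero_le, zero_mul]; exact zero_le
  have hsamp := proposals_rejectionSample_ne_le (sum_digitLaw P hP0) (sum_digitLaw Q hQ0)
  have hf1 : Measurable fun z : AddCircle (1 : ℝ) × AddCircle (1 : ℝ) => arcIndex b (j + 1) z.1 :=
    (measurable_arcIndex b (j + 1)).comp measurable_fst
  have hf2 : Measurable fun z : AddCircle (1 : ℝ) × AddCircle (1 : ℝ) => arcIndex b (j + 1) z.2 :=
    (measurable_arcIndex b (j + 1)).comp measurable_snd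
  rcases le_total (P {x | arcIndex b j x = k}) (Q {x | arcIndex b j x = k}) with hle | hle
  · calc _ ≤ _ := mul_le_mul_right hsamp m
      _ ≤ 2 * ∑ a : Fin b, (Q {x | arcIndex b (j + 1) x = b * k + a} -
            P {x | arcIndex b (j + 1) x = b * k + a}) :=
          mul_sum_div_sub_div_le _ _ (sum_measure_arcIndex_succ P j k)
            (sum_measure_arcIndex_succ Q j k) (measure_ne_top _ _) (measure_ne_top _ _) hP0 hle hmP
      _ ≤ 2 * γ {z | arcIndex b (j + 1) z.2 / b = k ∧
          arcIndex b (j + 1) z.1 ≠ arcIndex b (j + 1) z.2} := by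
          gcongr
          simp only [hPi, hQi]
          exact sum_measure_sub_measure_le γ hf1 hf2 hb k
      _ ≤ _ := by
          gcongr
          refine (measure_mono fun z hz => ?_).trans (measure_union_le _ _)
          obtain ⟨h1, h2⟩ := hz
          rw [arcIndex_succ_div] at h1
          by_cases h : arcIndex b j z.1 = k
          · exact Or.inl ⟨h, h2⟩
          · exact Or.inr ⟨h1, fun h' => h (h'.trans h1)⟩
  · calc _ ≤ _ := mul_le_mul_right hsamp m
      _ ≤ 2 * ∑ a : Fin b, (P {x | arcIndex b (j + 1) x = b * k + a} -
            Q {x | arcIndex b (j + 1) x = b * k + a}) := by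
          rw [add_comm]
          exact mul_sum_div_sub_div_le _ _ (sum_measure_arcIndex_succ Q j k)
            (sum_measure_arcIndex_succ P j k) (measure_ne_top _ _) (measure_ne_top _ _) hQ0 hle hmQ
      _ ≤ 2 * γ {z | arcIndex b (j + 1) z.1 / b = k ∧
          arcIndex b (j + 1) z.2 ≠ arcIndex b (j + 1) z.1} := by
          gcongr
          simp only [hPi, hQi]
          exact sum_measure_sub_measure_le γ hf2 hf1 hb k
      _ ≤ _ := by
          gcongr
          refine (measure_mono fun z hz => ?_).trans le_self_add
          obtain ⟨h1, h2⟩ := hz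
          rw [arcIndex_succ_div] at h1
          exact ⟨h1, h2.symm⟩

theorem chainSource_first_split_le [NeZero b]
    (γ : Measure (AddCircle (1 : ℝ) × AddCircle (1 : ℝ))) [IsProbabilityMeasure γ] (j : ℕ) :
    chainSource b {ω | arcChain b (γ.map Prod.fst) ω j = arcChain b (γ.map Prod.snd) ω j ∧
        arcChain b (γ.map Prod.fst) ω (j + 1) ≠ arcChain b (γ.map Prod.snd) ω (j + 1)} ≤
      2 * (γ (separated b (j + 1)) + γ (separated b j)) := by
  calc _ ≤ chainSource b (⋃ k, {ω | arcChain b (γ.map Prod.fst) ω j = k ∧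
        arcChain b (γ.map Prod.snd) ω j = k ∧
        arcChain b (γ.map Prod.fst) ω (j + 1) ≠ arcChain b (γ.map Prod.snd) ω (j + 1)}) :=
        measure_mono fun ω hω => Set.mem_iUnion.2 ⟨_, rfl, hω.1.symm, hω.2⟩
    _ ≤ _ := measure_iUnion_le _
    _ ≤ _ := ENNReal.tsum_le_tsum fun k => chainSource_split_le γ j k
    _ ≤ _ := by
        rw [ENNReal.tsum_mul_left, ENNReal.tsum_add]
        gcongr
        · exact tsum_measure_eq_inter_le γ ((measurable_arcIndex b j).comp measurable_fst)
            (measurableSet_separated _)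
        · exact tsum_measure_eq_inter_le γ ((measurable_arcIndex b j).comp measurable_snd)
            (measurableSet_separated _)

end Chain

section Chain

variable {b : ℕ}

theorem arcChain_mul_le (P : Measure (AddCircle (1 : ℝ))) (ω : ℕ → ℕ → Fin b × ℝ) (j : ℕ) :
    b * arcChain b P ω j ≤ arcChain b P ω (j + 1) := by
  simp [arcChain]

theorem arcChain_succ_lt (P : Measure (AddCircle (1 : ℝ))) (ω : ℕ → ℕ → Fin b × ℝ) (j : ℕ) :
    arcChain b P ω (j + 1) + 1 ≤ b * (arcChain b P ω j + 1) := by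
  simp only [arcChain, mul_add, mul_one]
  have := (rejectionSample (digitLaw b P j (arcChain b P ω j)) (ω j)).2
  omega

theorem tendsto_arcIndex_div (hb : 2 ≤ b) (x : AddCircle (1 : ℝ)) :
    Filter.Tendsto (fun j => (arcIndex b j x : ℝ) / (b : ℝ) ^ j) Filter.atTop
      (nhds (circleRep x)) := by
  have hb' : (1 : ℝ) < b := by exact_mod_cast hb
  have h := (tendsto_nat_floor_mul_div_atTop (circleRep_nonneg x)).comp
    (tendsto_pow_atTop_atTop_of_one_lt hb')
  refine h.congr fun j => ?_
  simp [arcIndex, mul_comm]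

variable (b) in
/-- The point of `[0, 1]` determined by the nested arcs of `arcChain`. -/
def chainLimit (P : Measure (AddCircle (1 : ℝ))) (ω : ℕ → ℕ → Fin b × ℝ) : ℝ :=
  ⨆ j, (arcChain b P ω j : ℝ) / (b : ℝ) ^ j

theorem measurable_chainLimit
    (κ : ProbabilityTheory.Kernel (AddCircle (1 : ℝ)) (AddCircle (1 : ℝ))) :
    Measurable fun z : AddCircle (1 : ℝ) × (ℕ → ℕ → Fin b × ℝ) =>
      chainLimit b (κ z.1) z.2 :=
  Measurable.iSup fun j =>
    ((measurable_of_countable (fun n : ℕ => (n : ℝ))).comp (measurable_arcChain κ j)).div_const _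

theorem measurable_chainLimit_apply (P : Measure (AddCircle (1 : ℝ))) :
    Measurable fun ω => chainLimit b P ω :=
  Measurable.iSup fun j => ((measurable_of_countable (fun n : ℕ => (n : ℝ))).comp
    (measurable_arcChain_apply P j)).div_const _

variable (b) in
/-- The event that the arc chains of `P` and `Q` split at generation `j + 1` after agreeing at
generation `j`. -/
def splitAt (P Q : Measure (AddCircle (1 : ℝ))) (j : ℕ) : Set (ℕ → ℕ → Fin b × ℝ) :=
  {ω | arcChain b P ω j = arcChain b Q ω j ∧ arcChain b P ω (j + 1) ≠ arcChain b Q ω (j + 1)}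

theorem measurableSet_splitAt (P Q : Measure (AddCircle (1 : ℝ))) (j : ℕ) :
    MeasurableSet (splitAt b P Q j) :=
  (measurableSet_eq_fun (measurable_arcChain_apply P j) (measurable_arcChain_apply Q j)).inter
    (measurableSet_eq_fun (measurable_arcChain_apply P (j + 1))
      (measurable_arcChain_apply Q (j + 1))).compl

variable (b) in
/-- The cost of a pair of nested arc chains which first split after generation `j`. -/
def splitCost (q : ℝ) (j : ℕ) : ℝ≥0∞ := ENNReal.ofReal ((((b : ℝ) ^ j)⁻¹) ^ q)

variable (b) in
/-- A bound for the expected cost between the limits of the chains of two point masses. -/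
def splitBound (q : ℝ) (x y : AddCircle (1 : ℝ)) : ℝ≥0∞ :=
  ∑' j, splitCost b q j *
    (2 * ((separated b (j + 1)).indicator 1 (x, y) + (separated b j).indicator 1 (x, y)))

theorem measurable_splitBound (q : ℝ) : Measurable (Function.uncurry (splitBound b q)) := by
  refine Measurable.tsum fun j => Measurable.const_mul (Measurable.const_mul ?_ _) _
  exact (measurable_one.indicator (measurableSet_separated (j + 1))).add
    (measurable_one.indicator (measurableSet_separated j))

theorem lintegral_splitBound (q : ℝ) (γ : Measure (AddCircle (1 : ℝ) × AddCircle (1 : ℝ))) :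
    ∫⁻ z, splitBound b q z.1 z.2 ∂γ =
      ∑' j, splitCost b q j * (2 * (γ (separated b (j + 1)) + γ (separated b j))) := by
  have hm (j : ℕ) : Measurable fun z : AddCircle (1 : ℝ) × AddCircle (1 : ℝ) =>
      (separated b j).indicator (1 : AddCircle (1 : ℝ) × AddCircle (1 : ℝ) → ℝ≥0∞) (z.1, z.2) :=
    measurable_one.indicator (measurableSet_separated j)
  have hint (j : ℕ) : ∫⁻ z : AddCircle (1 : ℝ) × AddCircle (1 : ℝ),
      (separated b j).indicator (1 : AddCircle (1 : ℝ) × AddCircle (1 : ℝ) → ℝ≥0∞) (z.1, z.2) ∂γ =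
      γ (separated b j) := lintegral_indicator_one (measurableSet_separated j)
  have hm2 (j : ℕ) : Measurable fun z : AddCircle (1 : ℝ) × AddCircle (1 : ℝ) =>
      (separated b (j + 1)).indicator (1 : AddCircle (1 : ℝ) × AddCircle (1 : ℝ) → ℝ≥0∞) (z.1, z.2)
        + (separated b j).indicator (1 : AddCircle (1 : ℝ) × AddCircle (1 : ℝ) → ℝ≥0∞) (z.1, z.2) :=
    (hm (j + 1)).add (hm j)
  simp only [splitBound]
  rw [lintegral_tsum fun j => (((hm2 j).const_mul 2).const_mul (splitCost b q j)).aemeasurable]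
  refine tsum_congr fun j => ?_
  rw [lintegral_const_mul _ ((hm2 j).const_mul 2), lintegral_const_mul _ (hm2 j),
    lintegral_add_left (hm (j + 1)), hint, hint]

variable [NeZero b]

theorem monotone_arcChain_div (P : Measure (AddCircle (1 : ℝ))) (ω : ℕ → ℕ → Fin b × ℝ) :
    Monotone fun j => (arcChain b P ω j : ℝ) / (b : ℝ) ^ j := by
  have hb : (0 : ℝ) < b := Nat.cast_pos.2 (Nat.pos_of_ne_zero (NeZero.ne b))
  refine monotone_nat_of_le_succ fun j => ?_
  rw [div_le_div_iff₀ (by positivity) (by positivity)]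
  have h : (b : ℝ) * arcChain b P ω j ≤ arcChain b P ω (j + 1) := by
    exact_mod_cast arcChain_mul_le P ω j
  calc (arcChain b P ω j : ℝ) * (b : ℝ) ^ (j + 1) = b * arcChain b P ω j * (b : ℝ) ^ j := by ring
    _ ≤ _ := by gcongr

theorem antitone_arcChain_add_one_div (P : Measure (AddCircle (1 : ℝ)))
    (ω : ℕ → ℕ → Fin b × ℝ) :
    Antitone fun j => ((arcChain b P ω j : ℝ) + 1) / (b : ℝ) ^ j := by
  have hb : (0 : ℝ) < b := Nat.cast_pos.2 (Nat.pos_of_ne_zero (NeZero.ne b))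
  refine antitone_nat_of_succ_le fun j => ?_
  rw [div_le_div_iff₀ (by positivity) (by positivity)]
  have h : (arcChain b P ω (j + 1) : ℝ) + 1 ≤ b * (arcChain b P ω j + 1) := by
    exact_mod_cast arcChain_succ_lt P ω j
  calc ((arcChain b P ω (j + 1) : ℝ) + 1) * (b : ℝ) ^ j
      ≤ b * (arcChain b P ω j + 1) * (b : ℝ) ^ j := by gcongr
    _ = _ := by ring

theorem arcChain_div_le (P : Measure (AddCircle (1 : ℝ))) (ω : ℕ → ℕ → Fin b × ℝ) (i j : ℕ) :
    (arcChain b P ω i : ℝ) / (b : ℝ) ^ i ≤ ((arcChain b P ω j : ℝ) + 1) / (b : ℝ) ^ j :=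
  calc (arcChain b P ω i : ℝ) / (b : ℝ) ^ i
      ≤ (arcChain b P ω (max i j) : ℝ) / (b : ℝ) ^ (max i j) :=
        monotone_arcChain_div P ω (le_max_left i j)
    _ ≤ ((arcChain b P ω (max i j) : ℝ) + 1) / (b : ℝ) ^ (max i j) := by gcongr; simp
    _ ≤ _ := antitone_arcChain_add_one_div P ω (le_max_right i j)

theorem bddAbove_arcChain_div (P : Measure (AddCircle (1 : ℝ))) (ω : ℕ → ℕ → Fin b × ℝ) :
    BddAbove (Set.range fun j => (arcChain b P ω j : ℝ) / (b : ℝ) ^ j) :=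
  ⟨_, Set.forall_mem_range.2 fun i => arcChain_div_le P ω i 0⟩

theorem tendsto_arcChain_div (P : Measure (AddCircle (1 : ℝ))) (ω : ℕ → ℕ → Fin b × ℝ) :
    Filter.Tendsto (fun j => (arcChain b P ω j : ℝ) / (b : ℝ) ^ j) Filter.atTop
      (nhds (chainLimit b P ω)) :=
  tendsto_atTop_ciSup (monotone_arcChain_div P ω) (bddAbove_arcChain_div P ω)

theorem arcChain_div_le_chainLimit (P : Measure (AddCircle (1 : ℝ)))
    (ω : ℕ → ℕ → Fin b × ℝ) (j : ℕ) : (arcChain b P ω j : ℝ) / (b : ℝ) ^ j ≤ chainLimit b P ω :=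
  le_ciSup (bddAbove_arcChain_div P ω) j

theorem chainLimit_le (P : Measure (AddCircle (1 : ℝ))) (ω : ℕ → ℕ → Fin b × ℝ) (j : ℕ) :
    chainLimit b P ω ≤ ((arcChain b P ω j : ℝ) + 1) / (b : ℝ) ^ j :=
  ciSup_le fun i => arcChain_div_le P ω i j

theorem map_arcChain (P : Measure (AddCircle (1 : ℝ))) [IsProbabilityMeasure P] (j : ℕ) :
    (chainSource b).map (fun ω => arcChain b P ω j) = P.map (arcIndex b j) := by
  refine Measure.ext_of_singleton fun k => ?_
  rw [Measure.map_apply (measurable_arcChain_apply P j) (measurableSet_singleton k),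
    Measure.map_apply (measurable_arcIndex b j) (measurableSet_singleton k)]
  exact chainSource_arcChain_eq P j k

theorem map_chainLimit (hb : 2 ≤ b) (P : Measure (AddCircle (1 : ℝ))) [IsProbabilityMeasure P] :
    (chainSource b).map (fun ω => (chainLimit b P ω : AddCircle (1 : ℝ))) = P := by
  have hmeas : Measurable fun ω => (chainLimit b P ω : AddCircle (1 : ℝ)) :=
    AddCircle.measurable_mk'.comp (measurable_chainLimit_apply P)
  have : IsProbabilityMeasure
      ((chainSource b).map (fun ω => (chainLimit b P ω : AddCircle (1 : ℝ)))) :=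
    Measure.isProbabilityMeasure_map hmeas.aemeasurable
  refine ext_of_forall_integral_eq_of_IsFiniteMeasure fun f => ?_
  rw [integral_map hmeas.aemeasurable f.continuous.aestronglyMeasurable]
  have hcont : Continuous fun t : ℝ => f (t : AddCircle (1 : ℝ)) :=
    f.continuous.comp (AddCircle.continuous_mk' 1)
  have hm (j : ℕ) : Measurable fun k : ℕ => f (((k : ℝ) / (b : ℝ) ^ j : ℝ) : AddCircle (1 : ℝ)) :=
    measurable_of_countable _
  have h1 : Filter.Tendsto (fun j => ∫ ω, f (((arcChain b P ω j : ℝ) / (b : ℝ) ^ j : ℝ) :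
      AddCircle (1 : ℝ)) ∂chainSource b) Filter.atTop
      (nhds (∫ ω, f (chainLimit b P ω : AddCircle (1 : ℝ)) ∂chainSource b)) := by
    refine tendsto_integral_of_dominated_convergence (fun _ => ‖f‖)
      (fun j => ((hm j).comp (measurable_arcChain_apply P j)).aestronglyMeasurable)
      (integrable_const _) (fun j => Filter.Eventually.of_forall fun ω => f.norm_coe_le_norm _)
      (Filter.Eventually.of_forall fun ω => ?_)
    exact (hcont.tendsto _).comp (tendsto_arcChain_div P ω)
  have h2 : Filter.Tendsto (fun j => ∫ x, f (((arcIndex b j x : ℝ) / (b : ℝ) ^ j : ℝ) :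
      AddCircle (1 : ℝ)) ∂P) Filter.atTop (nhds (∫ x, f x ∂P)) := by
    refine tendsto_integral_of_dominated_convergence (fun _ => ‖f‖)
      (fun j => ((hm j).comp (measurable_arcIndex b j)).aestronglyMeasurable)
      (integrable_const _) (fun j => Filter.Eventually.of_forall fun ω => f.norm_coe_le_norm _)
      (Filter.Eventually.of_forall fun x => ?_)
    have := (hcont.tendsto _).comp (tendsto_arcIndex_div hb x)
    rwa [coe_circleRep] at this
  refine tendsto_nhds_unique h1 (h2.congr fun j => ?_)
  have e1 := integral_map (μ := chainSource b) (measurable_arcChain_apply P j).aemeasurable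
    (hm j).aestronglyMeasurable
  have e2 := integral_map (μ := P) (measurable_arcIndex b j).aemeasurable
    (hm j).aestronglyMeasurable
  rw [← e1, ← e2, map_arcChain]

theorem norm_chainLimit_sub_le {P Q : Measure (AddCircle (1 : ℝ))} {ω : ℕ → ℕ → Fin b × ℝ}
    {j : ℕ} (h : arcChain b P ω j = arcChain b Q ω j) :
    ‖(chainLimit b P ω : AddCircle (1 : ℝ)) - (chainLimit b Q ω : AddCircle (1 : ℝ))‖ ≤
      ((b : ℝ) ^ j)⁻¹ := by
  refine (norm_coe_sub_coe_le _ _).trans ?_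
  have h1 := arcChain_div_le_chainLimit P ω j
  have h2 := arcChain_div_le_chainLimit Q ω j
  have h3 := chainLimit_le P ω j
  have h4 := chainLimit_le Q ω j
  rw [h] at h1 h3
  rw [add_div, one_div] at h3 h4
  rw [abs_le]
  constructor <;> linarith

theorem ofReal_norm_chainLimit_sub_rpow_le {q : ℝ} (hq : 0 < q)
    (P Q : Measure (AddCircle (1 : ℝ))) (ω : ℕ → ℕ → Fin b × ℝ) :
    ENNReal.ofReal (‖(chainLimit b P ω : AddCircle (1 : ℝ)) -
        (chainLimit b Q ω : AddCircle (1 : ℝ))‖ ^ q) ≤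
      ∑' j, splitCost b q j * (splitAt b P Q j).indicator 1 ω := by
  by_cases hall : ∀ j, arcChain b P ω j = arcChain b Q ω j
  · have : chainLimit b P ω = chainLimit b Q ω := by simp [chainLimit, hall]
    rw [this, sub_self, norm_zero, Real.zero_rpow hq.ne', ENNReal.ofReal_zero]
    exact zero_le
  classical
  push Not at hall
  obtain ⟨j, hj⟩ : ∃ j, Nat.find hall = j + 1 :=
    Nat.exists_eq_succ_of_ne_zero fun h0 => (h0 ▸ Nat.find_spec hall) rfl
  have h1 : arcChain b P ω j = arcChain b Q ω j := by
    by_contra h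
    exact Nat.find_min hall (by omega) h
  have h2 : arcChain b P ω (j + 1) ≠ arcChain b Q ω (j + 1) := hj ▸ Nat.find_spec hall
  refine le_trans ?_ (ENNReal.le_tsum j)
  rw [Set.indicator_of_mem (show ω ∈ splitAt b P Q j from ⟨h1, h2⟩),
    Pi.one_apply, mul_one, splitCost]
  exact ENNReal.ofReal_le_ofReal
    (Real.rpow_le_rpow (norm_nonneg _) (norm_chainLimit_sub_le h1) hq.le)

theorem lintegral_norm_chainLimit_sub_rpow_le {q : ℝ} (hq : 0 < q)
    (γ : Measure (AddCircle (1 : ℝ) × AddCircle (1 : ℝ))) [IsProbabilityMeasure γ] :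
    ∫⁻ ω, ENNReal.ofReal (‖(chainLimit b (γ.map Prod.fst) ω : AddCircle (1 : ℝ)) -
        (chainLimit b (γ.map Prod.snd) ω : AddCircle (1 : ℝ))‖ ^ q) ∂chainSource b ≤
      ∫⁻ z, splitBound b q z.1 z.2 ∂γ := by
  have hS := measurableSet_splitAt (b := b) (γ.map Prod.fst) (γ.map Prod.snd)
  refine (lintegral_mono fun ω => ofReal_norm_chainLimit_sub_rpow_le hq _ _ ω).trans ?_
  rw [lintegral_tsum fun j => ((measurable_one.indicator (hS j)).const_mul _).aemeasurable]
  rw [lintegral_splitBound]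
  refine ENNReal.tsum_le_tsum fun j => ?_
  rw [lintegral_const_mul _ (measurable_one.indicator (hS j)), lintegral_indicator_one (hS j)]
  gcongr
  exact chainSource_first_split_le γ j

end Chain

theorem volume_le_circleRep_le (c : ℝ) :
    volume {v : AddCircle (1 : ℝ) | c ≤ circleRep v} ≤ ENNReal.ofReal (1 - c) := by
  have hm : MeasurableSet {v : AddCircle (1 : ℝ) | c ≤ circleRep v} :=
    measurable_circleRep measurableSet_Ici
  rw [AddCircle.add_projection_respects_measure (T := 1) 0 hm, zero_add]
  calc _ ≤ volume (Set.Icc c 1) := by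
        refine measure_mono fun t ht => ⟨?_, ht.2.2⟩
        have h1 : c ≤ circleRep (t : AddCircle (1 : ℝ)) := ht.1
        rw [circleRep_coe] at h1
        exact h1.trans
            (by linarith [Int.self_sub_floor t, Int.cast_nonneg (R := ℝ) (Int.floor_nonneg.2 ht.2.1.le)])
    _ = _ := Real.volume_Icc

theorem arcIndex_add_eq {b : ℕ} (hb : 0 < b) {j : ℕ} {s : ℝ} (hs : 0 ≤ s) {v : AddCircle (1 : ℝ)}
    (h : circleRep ((b ^ j) • v) < 1 - (b : ℝ) ^ j * s) :
    arcIndex b j ((s : AddCircle (1 : ℝ)) + v) = arcIndex b j v := by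
  set τ := circleRep v with hτ
  have hτ0 : 0 ≤ τ := circleRep_nonneg v
  have hτ1 : τ < 1 := circleRep_lt_one v
  have hv : v = (τ : AddCircle (1 : ℝ)) := (coe_circleRep v).symm
  obtain ⟨N, hN⟩ : ∃ N : ℕ, N = b ^ j := ⟨_, rfl⟩
  have hNr : (b : ℝ) ^ j = N := by rw [hN]; push_cast; rfl
  rw [← hN, hNr, hv, ← AddCircle.coe_nsmul, circleRep_coe, nsmul_eq_mul] at h
  have hNτ : 0 ≤ (N : ℝ) * τ := by positivity
  have hfl : ((⌊(N : ℝ) * τ⌋₊ : ℕ) : ℝ) + Int.fract ((N : ℝ) * τ) = N * τ := by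
    have := Int.floor_add_fract ((N : ℝ) * τ)
    rwa [← natCast_floor_eq_intCast_floor hNτ] at this
  have hlt : (N : ℝ) * (s + τ) < (⌊(N : ℝ) * τ⌋₊ : ℕ) + 1 := by rw [mul_add]; linarith
  have hNpos : (0 : ℝ) < N := by rw [← hNr]; positivity
  have hle : ⌊(N : ℝ) * τ⌋₊ + 1 ≤ N := (Nat.floor_lt hNτ).2 (by nlinarith)
  have hst : s + τ < 1 := by
    have : ((⌊(N : ℝ) * τ⌋₊ : ℕ) : ℝ) + 1 ≤ N := by exact_mod_cast hle
    by_contra hcon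
    nlinarith
  have hrep : circleRep ((s : AddCircle (1 : ℝ)) + v) = s + τ := by
    rw [hv, ← AddCircle.coe_add, circleRep_coe]
    exact Int.fract_eq_self.2 ⟨by positivity, hst⟩
  rw [arcIndex, arcIndex, hrep, ← hτ, hNr]
  rw [Nat.floor_eq_iff (by positivity)]
  refine ⟨(Nat.floor_le hNτ).trans ?_, hlt⟩
  gcongr
  linarith

theorem exists_eq_coe_norm (x : AddCircle (1 : ℝ)) :
    x = (‖x‖ : ℝ) ∨ -x = (‖x‖ : ℝ) := by
  obtain ⟨t, rfl⟩ := QuotientAddGroup.mk_surjective x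
  have h : ((t - round t : ℝ) : AddCircle (1 : ℝ)) = (t : AddCircle (1 : ℝ)) := by
    rw [AddCircle.coe_sub, sub_eq_self]
    exact AddCircle.coe_eq_zero_iff 1 |>.2 ⟨round t, by simp⟩
  change (t : AddCircle (1 : ℝ)) = _ ∨ -(t : AddCircle (1 : ℝ)) = (‖(t : AddCircle (1 : ℝ))‖ : ℝ)
  rw [UnitAddCircle.norm_eq]
  rcases abs_choice (t - round t) with h' | h' <;> rw [h']
  · exact Or.inl h.symm
  · right; rw [AddCircle.coe_neg, h]

section Chain

variable {b : ℕ} [NeZero b]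

theorem volume_separated_le_aux (j : ℕ) {s : ℝ} (hs : 0 ≤ s) :
    volume {v : AddCircle (1 : ℝ) | arcIndex b j ((s : AddCircle (1 : ℝ)) + v) ≠ arcIndex b j v} ≤
      ENNReal.ofReal ((b : ℝ) ^ j * s) := by
  have : IsProbabilityMeasure (volume : Measure (AddCircle (1 : ℝ))) := ⟨UnitAddCircle.measure_univ⟩
  rcases le_or_gt 1 ((b : ℝ) ^ j * s) with h1 | h1
  · refine prob_le_one.trans ?_
    rw [← ENNReal.ofReal_one]
    exact ENNReal.ofReal_le_ofReal h1
  have hne : ((b ^ j : ℕ) : ℤ) ≠ 0 := by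
    exact_mod_cast (pow_ne_zero j (NeZero.ne b))
  have hmp := Measure.measurePreserving_zsmul (volume : Measure (AddCircle (1 : ℝ))) hne
  have hm : MeasurableSet {v : AddCircle (1 : ℝ) | 1 - (b : ℝ) ^ j * s ≤ circleRep v} :=
    measurable_circleRep measurableSet_Ici
  calc _ ≤ volume ((fun v => ((b ^ j : ℕ) : ℤ) • v) ⁻¹'
        {v : AddCircle (1 : ℝ) | 1 - (b : ℝ) ^ j * s ≤ circleRep v}) := by
        refine measure_mono fun v hv => ?_
        by_contra hcon
        refine hv (arcIndex_add_eq (Nat.pos_of_ne_zero (NeZero.ne b)) hs ?_)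
        rw [← natCast_zsmul]
        exact not_le.1 hcon
    _ = volume {v : AddCircle (1 : ℝ) | 1 - (b : ℝ) ^ j * s ≤ circleRep v} :=
        hmp.measure_preimage hm.nullMeasurableSet
    _ ≤ _ := by
        refine (volume_le_circleRep_le _).trans (ENNReal.ofReal_le_ofReal ?_)
        linarith

theorem volume_separated_le (j : ℕ) (x y : AddCircle (1 : ℝ)) :
    volume {u : AddCircle (1 : ℝ) | (x + u, y + u) ∈ separated b j} ≤
      ENNReal.ofReal ((b : ℝ) ^ j * ‖x - y‖) := by
  rcases exists_eq_coe_norm (x - y) with h | h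
  · refine le_trans (le_of_eq ?_) (volume_separated_le_aux (b := b) j (norm_nonneg (x - y)))
    rw [← h, ← measure_preimage_add volume y {v | arcIndex b j (x - y + v) ≠ arcIndex b j v}]
    congr 1
    ext u
    simp only [separated, Set.mem_ofPred_eq, Set.mem_preimage]
    rw [show x - y + (y + u) = x + u by abel]
  · refine le_trans (le_of_eq ?_) (volume_separated_le_aux (b := b) j (norm_nonneg (x - y)))
    rw [← h, ← measure_preimage_add volume x {v | arcIndex b j (-(x - y) + v) ≠ arcIndex b j v}]
    congr 1
    ext u
    simp only [separated, Set.mem_ofPred_eq, Set.mem_preimage]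
    rw [show -(x - y) + (x + u) = y + u by abel, ne_comm]

end Chain

theorem mul_add_le_mul_rpow {b q e : ℝ} (hb : 1 < b) (hq0 : 0 < q) (hq1 : q < 1)
    (he : b⁻¹ ≤ e) (he1 : e ≤ 1) :
    e * (b ^ (1 - q) / (b ^ (1 - q) - 1)) + 1 / (b ^ q - 1) ≤
      (1 / (b ^ q - 1) + b ^ (1 - q) / (b ^ (1 - q) - 1)) * e ^ q := by
  have hb0 : 0 < b := by linarith
  have he0 : 0 < e := lt_of_lt_of_le (by positivity) he
  obtain ⟨θ, hθ⟩ : ∃ θ, θ = -Real.logb b e := ⟨_, rfl⟩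
  have heθ : e = b ^ (-θ) := by rw [hθ, neg_neg, Real.rpow_logb hb0 hb.ne' he0]
  have hθ0 : 0 ≤ θ := by
    rw [hθ, neg_nonneg]; exact Real.logb_nonpos hb he0.le he1
  have hθ1 : θ ≤ 1 := by
    rw [hθ, neg_le, Real.le_logb_iff_rpow_le hb he0, Real.rpow_neg_one]; exact he
  set β := b ^ q with hβ
  set u := b ^ (1 - q) with hu
  have hβ1 : 1 < β := Real.one_lt_rpow hb hq0
  have hu1 : 1 < u := Real.one_lt_rpow hb (by linarith)
  have h1 : β ^ θ ≤ 1 + θ * (β - 1) := by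
    have := rpow_one_add_le_one_add_mul_self (s := β - 1) (p := θ) (by linarith) hθ0 hθ1
    simpa using this
  have h2 : (u⁻¹) ^ θ ≤ 1 + θ * (u⁻¹ - 1) := by
    have := rpow_one_add_le_one_add_mul_self (s := u⁻¹ - 1) (p := θ)
      (by linarith [inv_pos.2 (by linarith : 0 < u)]) hθ0 hθ1
    simpa using this
  have hβe : β ^ θ * e ^ q = 1 := by
    rw [hβ, heθ, ← Real.rpow_mul hb0.le, ← Real.rpow_mul hb0.le, ← Real.rpow_add hb0]
    simp [show q * θ + -(θ * q) = 0 by ring]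
  have hue : (u⁻¹) ^ θ * e ^ q = e := by
    rw [hu, heθ, ← Real.rpow_neg hb0.le, ← Real.rpow_mul hb0.le, ← Real.rpow_mul hb0.le,
      ← Real.rpow_add hb0]
    congr 1; ring
  have heq : 0 < e ^ q := Real.rpow_pos_of_pos he0 q
  have key : (u⁻¹) ^ θ * (u / (u - 1)) + β ^ θ * (1 / (β - 1)) ≤
      1 / (β - 1) + u / (u - 1) := by
    have hu' : 0 < u - 1 := by linarith
    have hβ' : 0 < β - 1 := by linarith
    have hu0 : 0 < u := by linarith
    calc _ ≤ (1 + θ * (u⁻¹ - 1)) * (u / (u - 1)) + (1 + θ * (β - 1)) * (1 / (β - 1)) := by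
          gcongr
      _ = _ := by field_simp; ring
  calc e * (u / (u - 1)) + 1 / (β - 1)
      = ((u⁻¹) ^ θ * (u / (u - 1)) + β ^ θ * (1 / (β - 1))) * e ^ q := by
        rw [add_mul, mul_right_comm, hue, mul_right_comm, hβe, one_mul]
    _ ≤ _ := by gcongr

theorem summable_inv_pow_mul_min {β : ℝ} (hβ : 1 < β) {b d : ℝ} (hb : 0 ≤ b) (hd : 0 ≤ d) :
    Summable fun j : ℕ => (β⁻¹) ^ j * min 1 (b ^ j * d) := by
  have hβ0 : 0 ≤ β⁻¹ := inv_nonneg.2 (by linarith)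
  refine Summable.of_nonneg_of_le (fun j => by positivity) (fun j => ?_)
    (summable_geometric_of_lt_one hβ0 (inv_lt_one_of_one_lt₀ hβ))
  exact mul_le_of_le_one_right (by positivity) (min_le_left _ _)

theorem tsum_inv_pow_mul_min_le {b q d : ℝ} (hb : 1 < b) (hq0 : 0 < q) (hq1 : q < 1)
    (hd0 : 0 < d) (hd1 : d ≤ 1) :
    ∑' j : ℕ, ((b ^ q)⁻¹) ^ j * min 1 (b ^ j * d) ≤
      (1 / (b ^ q - 1) + b ^ (1 - q) / (b ^ (1 - q) - 1)) * d ^ q := by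
  have hb0 : 0 < b := by linarith
  obtain ⟨J, hJ1, hJ2⟩ := exists_nat_pow_near_of_lt_one hd0 hd1 (inv_pos.2 hb0)
    (inv_lt_one_of_one_lt₀ hb)
  have hbJ : 0 < b ^ J := by positivity
  have key := mul_add_le_mul_rpow (e := b ^ J * d) hb hq0 hq1
    (by rw [pow_succ, inv_pow, ← div_eq_inv_mul, div_lt_iff₀ hbJ, mul_comm] at hJ1; exact hJ1.le)
    (by rwa [inv_pow, ← one_div, le_div_iff₀ hbJ, mul_comm] at hJ2)
  set β := b ^ q with hβ
  set u := b ^ (1 - q) with hu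
  have hβ1 : 1 < β := Real.one_lt_rpow hb hq0
  have hu1 : 1 < u := Real.one_lt_rpow hb (by linarith)
  have hβ0 : 0 < β := by linarith
  have hbu : b = β * u := by
    rw [hβ, hu, ← Real.rpow_add hb0]; simp
  have hsum := summable_inv_pow_mul_min hβ1 hb0.le hd0.le
  rw [← hsum.sum_add_tsum_nat_add (J + 1)]
  have hhead : ∑ j ∈ Finset.range (J + 1), (β⁻¹) ^ j * min 1 (b ^ j * d) ≤
      (β⁻¹) ^ J * (b ^ J * d * (u / (u - 1))) := by
    calc _ ≤ ∑ j ∈ Finset.range (J + 1), u ^ j * d := by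
          refine Finset.sum_le_sum fun j _ => ?_
          calc (β⁻¹) ^ j * min 1 (b ^ j * d) ≤ (β⁻¹) ^ j * (b ^ j * d) := by
                gcongr; exact min_le_right _ _
            _ = u ^ j * d := by rw [hbu, mul_pow, inv_pow]; field_simp
      _ = (u ^ (J + 1) - 1) / (u - 1) * d := by
          rw [← Finset.sum_mul, geom_sum_eq hu1.ne']
      _ ≤ u ^ (J + 1) / (u - 1) * d := by
          gcongr
          linarith
      _ = _ := by
          have : u - 1 ≠ 0 := by linarith
          rw [hbu, mul_pow, inv_pow, pow_succ]; field_simp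
  have htail : ∑' j : ℕ, (β⁻¹) ^ (j + (J + 1)) * min 1 (b ^ (j + (J + 1)) * d) ≤
      (β⁻¹) ^ J * (1 / (β - 1)) := by
    have hgeo := (hasSum_geometric_of_lt_one (inv_nonneg.2 hβ0.le)
      (inv_lt_one_of_one_lt₀ hβ1)).mul_left ((β⁻¹) ^ (J + 1))
    have hle : ∀ j : ℕ, (β⁻¹) ^ (j + (J + 1)) * min 1 (b ^ (j + (J + 1)) * d) ≤
        (β⁻¹) ^ (J + 1) * (β⁻¹) ^ j := fun j => by
      rw [← pow_add, add_comm (J + 1)]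
      exact mul_le_of_le_one_right (by positivity) (min_le_left _ _)
    refine (((summable_nat_add_iff (J + 1)).2 hsum).tsum_le_tsum hle hgeo.summable).trans
      (le_of_eq ?_)
    have : β - 1 ≠ 0 := by linarith
    rw [hgeo.tsum_eq, pow_succ]
    field_simp
  calc _ ≤ (β⁻¹) ^ J * (b ^ J * d * (u / (u - 1))) + (β⁻¹) ^ J * (1 / (β - 1)) :=
        add_le_add hhead htail
    _ = (β⁻¹) ^ J * (b ^ J * d * (u / (u - 1)) + 1 / (β - 1)) := by ring
    _ ≤ (β⁻¹) ^ J * ((1 / (β - 1) + u / (u - 1)) * (b ^ J * d) ^ q) := by gcongr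
    _ = _ := by
        rw [Real.mul_rpow hbJ.le hd0.le, ← Real.rpow_natCast b J, ← Real.rpow_mul hb0.le,
          mul_comm (J : ℝ) q, Real.rpow_mul hb0.le, Real.rpow_natCast, ← hβ, inv_pow]
        field_simp

/-- The bound for the coupling ratio given by the nested arc chains in base `b`. -/
def chainRatio (b q : ℝ) : ℝ :=
  2 * (1 + b ^ q) * (1 / (b ^ q - 1) + b ^ (1 - q) / (b ^ (1 - q) - 1))

section Chain

variable {b : ℕ}

theorem splitCost_eq (q : ℝ) (j : ℕ) :
    splitCost b q j = ENNReal.ofReal ((((b : ℝ) ^ q)⁻¹) ^ j) := by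
  rw [splitCost, Real.inv_rpow (by positivity), ← Real.rpow_natCast,
    ← Real.rpow_mul (by positivity),
    mul_comm, Real.rpow_mul (by positivity), Real.rpow_natCast, inv_pow]

theorem lintegral_splitBound_translate (q : ℝ) (x y : AddCircle (1 : ℝ)) :
    ∫⁻ u, splitBound b q (x + u) (y + u) = ∑' j, splitCost b q j *
      (2 * (volume {u : AddCircle (1 : ℝ) | (x + u, y + u) ∈ separated b (j + 1)} +
        volume {u : AddCircle (1 : ℝ) | (x + u, y + u) ∈ separated b j})) := by
  have hmap : Measurable fun u : AddCircle (1 : ℝ) => (x + u, y + u) :=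
    (measurable_const_add x).prodMk (measurable_const_add y)
  have hsep (j : ℕ) : (volume : Measure (AddCircle (1 : ℝ))).map (fun u => (x + u, y + u))
      (separated b j) = volume {u : AddCircle (1 : ℝ) | (x + u, y + u) ∈ separated b j} :=
    Measure.map_apply hmap (measurableSet_separated j)
  have h := lintegral_splitBound (b := b) q
    ((volume : Measure (AddCircle (1 : ℝ))).map fun u => (x + u, y + u))
  simp only [hsep] at h
  rw [← h]
  exact (lintegral_map (measurable_splitBound q) hmap).symm

theorem tsum_splitCost_mul_shift {q : ℝ} (hb : 0 < b) {p : ℕ → ℝ≥0∞} (hp0 : p 0 = 0) :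
    ∑' j, splitCost b q j * p (j + 1) =
      ENNReal.ofReal ((b : ℝ) ^ q) * ∑' j, splitCost b q j * p j := by
  have hb0 : (0 : ℝ) < b := by exact_mod_cast hb
  have hβ0 : 0 < (b : ℝ) ^ q := Real.rpow_pos_of_pos hb0 q
  rw [tsum_eq_zero_add' (f := fun j => splitCost b q j * p j) ENNReal.summable, hp0, mul_zero,
    zero_add, ← ENNReal.tsum_mul_left]
  refine tsum_congr fun j => ?_
  rw [← mul_assoc, splitCost_eq, splitCost_eq, ← ENNReal.ofReal_mul hβ0.le, pow_succ']
  congr 2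
  field_simp

theorem tsum_splitCost_mul_le (hb : 2 ≤ b) {q : ℝ} (hq0 : 0 < q) (hq1 : q < 1) {d : ℝ}
    (hd0 : 0 < d) (hd1 : d ≤ 1) {p : ℕ → ℝ≥0∞} (hp1 : ∀ j, p j ≤ 1)
    (hpd : ∀ j, p j ≤ ENNReal.ofReal ((b : ℝ) ^ j * d)) :
    ∑' j, splitCost b q j * p j ≤ ENNReal.ofReal
      ((1 / ((b : ℝ) ^ q - 1) + (b : ℝ) ^ (1 - q) / ((b : ℝ) ^ (1 - q) - 1)) * d ^ q) := by
  have hb1 : (1 : ℝ) < b := by exact_mod_cast hb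
  have hsum := summable_inv_pow_mul_min (Real.one_lt_rpow hb1 hq0) (zero_le_one.trans hb1.le) hd0.le
  refine le_trans ?_ (ENNReal.ofReal_le_ofReal (tsum_inv_pow_mul_min_le hb1 hq0 hq1 hd0 hd1))
  rw [ENNReal.ofReal_tsum_of_nonneg (fun j => by positivity) hsum]
  refine ENNReal.tsum_le_tsum fun j => ?_
  rw [splitCost_eq, ENNReal.ofReal_mul (by positivity), ENNReal.ofReal_min, ENNReal.ofReal_one]
  exact mul_le_mul_right (le_min (hp1 j) (hpd j)) _

theorem tsum_splitCost_mul_two_mul_le (hb : 2 ≤ b) {q : ℝ} (hq0 : 0 < q) (hq1 : q < 1) {d : ℝ}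
    (hd0 : 0 < d) (hd1 : d ≤ 1) {p : ℕ → ℝ≥0∞} (hp0 : p 0 = 0) (hp1 : ∀ j, p j ≤ 1)
    (hpd : ∀ j, p j ≤ ENNReal.ofReal ((b : ℝ) ^ j * d)) :
    ∑' j, splitCost b q j * (2 * (p (j + 1) + p j)) ≤
      ENNReal.ofReal (chainRatio b q) * ENNReal.ofReal (d ^ q) := by
  have hb1 : (1 : ℝ) < b := by exact_mod_cast hb
  have hS := tsum_splitCost_mul_le hb hq0 hq1 hd0 hd1 hp1 hpd
  have hshift := tsum_splitCost_mul_shift (q := q) (by omega : 0 < b) hp0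
  have hβ1 : 1 < (b : ℝ) ^ q := Real.one_lt_rpow hb1 hq0
  have hu1 : 1 < (b : ℝ) ^ (1 - q) := Real.one_lt_rpow hb1 (by linarith)
  simp only [chainRatio]
  generalize (b : ℝ) ^ q = β at *
  generalize (b : ℝ) ^ (1 - q) = u at *
  have hβe : 1 + ENNReal.ofReal β = ENNReal.ofReal (1 + β) := by
    rw [ENNReal.ofReal_add zero_le_one (by linarith), ENNReal.ofReal_one]
  have h2 : (2 : ℝ≥0∞) = ENNReal.ofReal 2 := by simp
  have hβ' : 0 < β - 1 := by linarith
  have hu' : 0 < u - 1 := by linarith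
  calc ∑' j, splitCost b q j * (2 * (p (j + 1) + p j))
      = ∑' j, 2 * (splitCost b q j * p j + splitCost b q j * p (j + 1)) :=
        tsum_congr fun j => by ring
    _ = 2 * ENNReal.ofReal (1 + β) * ∑' j, splitCost b q j * p j := by
        rw [ENNReal.tsum_mul_left, ENNReal.tsum_add, hshift, ← hβe, mul_assoc, add_mul, one_mul]
    _ ≤ 2 * ENNReal.ofReal (1 + β) * ENNReal.ofReal ((1 / (β - 1) + u / (u - 1)) * d ^ q) :=
        mul_le_mul_right hS _
    _ = _ := by
        rw [h2, ← ENNReal.ofReal_mul (by norm_num), ← ENNReal.ofReal_mul (by positivity),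
          ← ENNReal.ofReal_mul (by positivity)]
        congr 1; ring

variable [NeZero b]

theorem lintegral_splitBound_translate_le (hb : 2 ≤ b) {q : ℝ} (hq0 : 0 < q) (hq1 : q < 1)
    (x y : AddCircle (1 : ℝ)) :
    ∫⁻ u, splitBound b q (x + u) (y + u) ≤
      ENNReal.ofReal (chainRatio b q) * ENNReal.ofReal (‖x - y‖ ^ q) := by
  have : IsProbabilityMeasure (volume : Measure (AddCircle (1 : ℝ))) := ⟨UnitAddCircle.measure_univ⟩
  rw [lintegral_splitBound_translate]
  rcases eq_or_ne x y with rfl | hxy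
  · simp [separated]
  have hd1 : ‖x - y‖ ≤ 1 := by
    have := AddCircle.norm_le_half_period (1 : ℝ) one_ne_zero (x := x - y)
    norm_num at this; linarith
  exact tsum_splitCost_mul_two_mul_le
    (p := fun j => volume {u : AddCircle (1 : ℝ) | (x + u, y + u) ∈ separated b j}) hb hq0 hq1
    (norm_pos_iff.2 (sub_ne_zero.2 hxy)) hd1 (by simp [separated_zero]) (fun j => prob_le_one)
    fun j => volume_separated_le j x y

end Chain

theorem circleOptRatio_le_chainRatio {b : ℕ} (hb : 2 ≤ b) {q : ℝ} (hq0 : 0 < q) (hq1 : q < 1) :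
    circleOptRatio q ≤ ENNReal.ofReal (chainRatio b q) := by
  have : NeZero b := ⟨by omega⟩
  refine circleOptRatio_le (chainSource b) (fun P ω => (chainLimit b P ω : AddCircle (1 : ℝ)))
    (fun κ _ => AddCircle.measurable_mk'.comp (measurable_chainLimit κ))
    (fun P _ => map_chainLimit hb P) (splitBound b q) (measurable_splitBound q)
    (fun γ _ => lintegral_norm_chainLimit_sub_rpow_le hq0 γ) ?_ ENNReal.ofReal_ne_top
    (lintegral_splitBound_translate_le hb hq0 hq1)
  have hb1 : (1 : ℝ) < b := by exact_mod_cast hb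
  have hu1 : 1 < (b : ℝ) ^ (1 - q) := Real.one_lt_rpow hb1 (by linarith)
  have hβ1 : 1 < (b : ℝ) ^ q := Real.one_lt_rpow hb1 hq0
  have h1 : 1 ≤ (b : ℝ) ^ (1 - q) / ((b : ℝ) ^ (1 - q) - 1) := by
    rw [le_div_iff₀ (by linarith)]; linarith
  have h2 : 0 ≤ 1 / ((b : ℝ) ^ q - 1) := one_div_nonneg.2 (by linarith)
  rw [← ENNReal.ofReal_one]
  refine ENNReal.ofReal_le_ofReal ?_
  rw [chainRatio]
  nlinarith

theorem chainRatio_four_lt {q : ℝ} (hq : 1 / 2 ≤ q) (hq1 : q < 1) :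
    chainRatio (4 : ℕ) q < 20.27 / (1 - q) := by
  have hx : 0 < 1 - q := by linarith
  rw [chainRatio, lt_div_iff₀ hx]
  push_cast
  have hβ2 : (2 : ℝ) ≤ 4 ^ q := by
    calc (2 : ℝ) = 4 ^ (1 / 2 : ℝ) := by
          rw [← Real.sqrt_eq_rpow, show (4 : ℝ) = 2 ^ 2 by norm_num,
            Real.sqrt_sq (by norm_num)]
      _ ≤ _ := Real.rpow_le_rpow_of_exponent_le (by norm_num) hq
  have hβ4 : (4 : ℝ) ^ q ≤ 4 := by
    calc (4 : ℝ) ^ q ≤ 4 ^ (1 : ℝ) := Real.rpow_le_rpow_of_exponent_le (by norm_num) hq1.le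
      _ = 4 := Real.rpow_one 4
  have hu : 1 + 1.38 * (1 - q) ≤ (4 : ℝ) ^ (1 - q) := by
    rw [Real.rpow_def_of_pos (by norm_num), show (4 : ℝ) = 2 ^ 2 by norm_num, Real.log_pow]
    have h1 := Real.log_two_gt_d9
    have h2 := Real.add_one_le_exp ((2 : ℕ) * Real.log 2 * (1 - q))
    push_cast at h2 ⊢
    nlinarith
  generalize (4 : ℝ) ^ q = β at *
  generalize (4 : ℝ) ^ (1 - q) = u at *
  have hu' : 0 < u - 1 := by nlinarith
  have hβ' : 0 < β - 1 := by linarith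
  have h1 : (1 + β) * β / (β - 1) ≤ 20 / 3 := by
    rw [div_le_iff₀ hβ']; nlinarith
  have h2 : (1 - q) / (u - 1) ≤ 1 / 1.38 := by
    rw [div_le_div_iff₀ hu' (by norm_num)]; linarith
  calc 2 * (1 + β) * (1 / (β - 1) + u / (u - 1)) * (1 - q)
      = 2 * ((1 + β) * β / (β - 1)) * (1 - q) + 2 * (1 + β) * ((1 - q) / (u - 1)) := by
        field_simp; ring
    _ ≤ 2 * (20 / 3) * (1 / 2) + 2 * (1 + 4) * (1 / 1.38) := by
        gcongr
        linarith
    _ < _ := by norm_num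

theorem exists_chainRatio_lt {q : ℝ} (hq0 : 0 < q) (hq : q < 1 / 2) :
    ∃ b : ℕ, 2 ≤ b ∧ chainRatio b q < 20.27 / (1 - q) := by
  set y : ℝ := 2 ^ (1 / q) with hy
  have hy4 : 4 < y := by
    calc (4 : ℝ) = 2 ^ (2 : ℝ) := by norm_num
      _ < _ := Real.rpow_lt_rpow_of_exponent_lt (by norm_num) (by rw [lt_div_iff₀ hq0]; linarith)
  have hyq : y ^ q = 2 := by
    rw [hy, ← Real.rpow_mul (by norm_num), one_div_mul_cancel hq0.ne', Real.rpow_one]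
  obtain ⟨b, hb⟩ : ∃ b : ℕ, b = ⌈y⌉₊ := ⟨_, rfl⟩
  have hby : y ≤ b := hb ▸ Nat.le_ceil y
  have hby' : (b : ℝ) < y + 1 := hb ▸ Nat.ceil_lt_add_one (by linarith)
  have hb5 : 5 ≤ b := by
    have : (4 : ℝ) < b := by linarith
    exact_mod_cast this
  have hb5r : (5 : ℝ) ≤ b := by exact_mod_cast hb5
  refine ⟨b, by omega, ?_⟩
  have hβ2 : (2 : ℝ) ≤ (b : ℝ) ^ q := hyq ▸ Real.rpow_le_rpow (by linarith) hby hq0.le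
  have hβ : (b : ℝ) ^ q ≤ 9 / 4 := by
    calc (b : ℝ) ^ q ≤ (y * (5 / 4)) ^ q := Real.rpow_le_rpow (by linarith) (by linarith) hq0.le
      _ = 2 * (5 / 4) ^ q := by rw [Real.mul_rpow (by linarith) (by norm_num), hyq]
      _ ≤ 2 * (5 / 4) ^ (1 / 2 : ℝ) := by
          gcongr
          norm_num
      _ ≤ 2 * (9 / 8) := by
          rw [← Real.sqrt_eq_rpow]
          gcongr
          rw [Real.sqrt_le_left (by norm_num)]; norm_num
      _ = _ := by norm_num
  have hu : (2.2 : ℝ) ≤ (b : ℝ) ^ (1 - q) := by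
    calc (2.2 : ℝ) ≤ √5 := Real.le_sqrt_of_sq_le (by norm_num)
      _ = 5 ^ (1 / 2 : ℝ) := Real.sqrt_eq_rpow 5
      _ ≤ 5 ^ (1 - q) := Real.rpow_le_rpow_of_exponent_le (by norm_num) (by linarith)
      _ ≤ _ := Real.rpow_le_rpow (by norm_num) hb5r (by linarith)
  have hx : 20.27 ≤ 20.27 / (1 - q) := by
    rw [le_div_iff₀ (by linarith)]; linarith
  refine lt_of_lt_of_le ?_ hx
  rw [chainRatio]
  generalize (b : ℝ) ^ q = β at *
  generalize (b : ℝ) ^ (1 - q) = u at *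
  have hu' : 0 < u - 1 := by linarith
  have hβ' : 0 < β - 1 := by linarith
  have h1 : (1 + β) * β / (β - 1) ≤ 6 := by
    rw [div_le_iff₀ hβ']; nlinarith
  calc 2 * (1 + β) * (1 / (β - 1) + u / (u - 1))
      = 2 * ((1 + β) * β / (β - 1)) + 2 * (1 + β) * (1 / (u - 1)) := by
        field_simp; ring
    _ ≤ 2 * 6 + 2 * (1 + 9 / 4) * (1 / (2.2 - 1)) := by
        gcongr
    _ < _ := by norm_num

theorem circleOptRatio_lt {q : ℝ} (hq0 : 0 < q) (hq1 : q < 1) :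
    circleOptRatio q < ENNReal.ofReal (20.27 / (1 - q)) := by
  obtain ⟨b, hb, h⟩ : ∃ b : ℕ, 2 ≤ b ∧ chainRatio b q < 20.27 / (1 - q) := by
    rcases lt_or_ge q (1 / 2) with h | h
    · exact exists_chainRatio_lt hq0 h
    · exact ⟨4, by norm_num, chainRatio_four_lt h hq1⟩
  refine (circleOptRatio_le_chainRatio hb hq0 hq1).trans_lt ?_
  exact (ENNReal.ofReal_lt_ofReal_iff (div_pos (by norm_num) (by linarith))).2 h

/-- for the circle `ℝ/ℤ` with its quotient metric and the cost
`c(x,y) = d(x,y)^q`: if `0 < q < 1` then `2 ≤ r*_c(P(X)) < 20.27/(1 − q)`;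
if `q = 1` then `r*_c(P(X)) = 2`; and if `q > 1` then `r*_c(P(X)) = ∞`. -/
theorem circle_optRatio (q : ℝ) (hq : 0 < q) :
    (q < 1 → 2 ≤ circleOptRatio q ∧ circleOptRatio q < ENNReal.ofReal (20.27 / (1 - q))) ∧
      (q = 1 → circleOptRatio q = 2) ∧
      (1 < q → circleOptRatio q = ⊤) := by
  refine ⟨fun h => ⟨two_le_circleOptRatio hq, circleOptRatio_lt hq h⟩, fun h => ?_,
    circleOptRatio_eq_top⟩
  subst h
  exact le_antisymm circleOptRatio_one_le (two_le_circleOptRatio one_pos)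

end
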